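/- Let {G_n}_{n≥1} be a sequence of uniformly nonamenable, transitive, locally finite, infinite connected graphs that converges locally to a transitive, locally finite, infinite connected graph G. If G satisfies Assumption 1 (parts (i) and (ii)), then p_c(G_n) → p_c(G) as n → ∞. -/

import Mathlib

/-!
Statement 0 (He–Xiang–Zhu, Theorem 1): locality of the percolation critical
probability for uniformly nonamenable sequences of transitive graphs whose
local limit satisfies Assumption 1.
-/

open Filter

namespace Loc

variable {V : Type*}

/-- `x` lies in the ball of radius `n` around `v` in `G` (graph distance via walks). -/
def inBall (G : SimpleGraph V) (v : V) (n : ℕ) (x : V) : Prop :=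
  ∃ w : G.Walk v x, w.length ≤ n

/-- `x` lies on the sphere `∂B_G(u,n) = B_G(u,n) \ B_G(u,n-1)`. -/
def onSphere (G : SimpleGraph V) (u : V) (n : ℕ) (x : V) : Prop :=
  inBall G u n x ∧ ¬ inBall G u (n - 1) x

/-- `x` and `y` are joined by a walk of `G` all of whose edges lie in the finite set `S`
(the set of open edges). -/
def connectedVia (G : SimpleGraph V) (S : Finset (Sym2 V)) (x y : V) : Prop :=
  ∃ w : G.Walk x y, ∀ e ∈ w.edges, e ∈ S

open Classical in
/-- The probability, under i.i.d. Bernoulli(`p`) bond percolation on the finite edge set `E`,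
of the event `A`; a configuration is recorded as its (finite) set of open edges. -/
noncomputable def cylProb (p : ℝ) (E : Finset (Sym2 V)) (A : Finset (Sym2 V) → Prop) : ℝ :=
  ∑ S ∈ E.powerset, if A S then p ^ S.card * (1 - p) ^ (E.card - S.card) else 0

/-- The probability of an increasing event `A` (an event witnessed by finitely many open
edges) under Bernoulli(`p`) bond percolation: the supremum over finite edge sets of the
finite-volume probabilities. -/
noncomputable def prob (p : ℝ) (A : Finset (Sym2 V) → Prop) : ℝ :=
  ⨆ E : Finset (Sym2 V), cylProb p E A

/-- `θ_G(p)` at the vertex `v`: the probability that `v` lies in an infinite open cluster,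
i.e. the infimum over `n` of the probability that `v` is connected to the complement of
the ball of radius `n`. -/
noncomputable def theta (G : SimpleGraph V) (p : ℝ) (v : V) : ℝ :=
  ⨅ n : ℕ, prob p (fun S => ∃ x : V, ¬ inBall G v n x ∧ connectedVia G S v x)

/-- The critical probability of Bernoulli bond percolation on `G`:
`p_c(G) = inf {p ∈ [0,1] : ℙ_p(∃ infinite open cluster) > 0}`.  (For a countable graph
there is an infinite cluster with positive probability iff `θ` is positive at some vertex.) -/
noncomputable def pc (G : SimpleGraph V) : ℝ :=
  sInf {p : ℝ | 0 ≤ p ∧ p ≤ 1 ∧ ∃ v : V, 0 < theta G p v}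

/-- `b_n(x,u)`: the probability that `x` is connected to `u` by open edges inside the
ball `B_G(u,n)` under Bernoulli(`p`) bond percolation. -/
noncomputable def bconn (G : SimpleGraph V) (p : ℝ) (u : V) (n : ℕ) (x : V) : ℝ :=
  prob p (fun S => ∃ w : G.Walk u x, (∀ e ∈ w.edges, e ∈ S) ∧ ∀ y ∈ w.support, inBall G u n y)

/-- `μ_n(x)`: the harmonic measure at `x ∈ ∂B_G(u,n)` of simple random walk on the
`d`-regular graph `G` started at `u`, i.e. `∑_γ d^{-|γ|}`, summed over all walks `γ`
from `u` to `x` whose vertices, except the last one, lie in `B_G(u,n-1)`. -/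
noncomputable def harm (G : SimpleGraph V) (d : ℕ) (u : V) (n : ℕ) (x : V) : ℝ :=
  ∑' w : {w : G.Walk u x // ∀ y ∈ w.support.dropLast, inBall G u (n - 1) y},
    ((d : ℝ))⁻¹ ^ (w : G.Walk u x).length

/-- `λ₁(G)`: the bottom of the spectrum of `I - P` for simple random walk on `G`,
computed in `ℓ²(V, deg)`; the infimum of the Rayleigh quotients of finitely supported
nonzero functions.  `G` is nonamenable iff `0 < lambda1 G`. -/
noncomputable def lambda1 (G : SimpleGraph V) : ℝ :=
  sInf {r : ℝ | ∃ f : V →₀ ℝ, f ≠ 0 ∧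
    r = (∑ x ∈ f.support,
          (((G.neighborSet x).ncard : ℝ) * f x - ∑' y : G.neighborSet x, f (y : V)) * f x) /
        (∑ x ∈ f.support, ((G.neighborSet x).ncard : ℝ) * f x ^ 2)}

/-- `G` is vertex-transitive. -/
def IsTransitive (G : SimpleGraph V) : Prop :=
  ∀ u v : V, ∃ φ : G ≃g G, φ u = v

/-- The balls `B_G(v,R)` and `B_H(w,R)` are isomorphic as rooted graphs. -/
def BallIso {W : Type*} (G : SimpleGraph V) (H : SimpleGraph W) (v : V) (w : W) (R : ℕ) :
    Prop :=
  ∃ φ : {x : V // inBall G v R x} ≃ {y : W // inBall H w R y},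
    (φ ⟨v, ⟨SimpleGraph.Walk.nil, by simp⟩⟩).1 = w ∧
    ∀ a b : {x : V // inBall G v R x}, G.Adj a.1 b.1 ↔ H.Adj (φ a).1 (φ b).1

/-- The sequence of transitive graphs `G n` converges locally to the transitive graph `H`:
for every radius `R` there is `N` such that for `n ≥ N` all `R`-balls of `G n` are
isomorphic, as rooted graphs, to the `R`-balls of `H`. -/
def ConvergesLocally {Vn : ℕ → Type*} {W : Type*} (G : ∀ n, SimpleGraph (Vn n))
    (H : SimpleGraph W) : Prop :=
  ∀ R : ℕ, ∃ N : ℕ, ∀ n, N ≤ n → ∀ (vn : Vn n) (w : W), BallIso (G n) H vn w R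

/-- Assumption 1(i): the harmonic measures on the spheres `∂B_G(u,n)` are roughly uniform,
with constants independent of `u` and `n`. -/
def Assumption1i (G : SimpleGraph V) (d : ℕ) : Prop :=
  ∃ c C : ℝ, 0 < c ∧ 0 < C ∧ ∀ (u : V) (n : ℕ), 1 ≤ n → ∀ x y : V,
    onSphere G u n x → onSphere G u n y →
      c * harm G d u n y ≤ harm G d u n x ∧ harm G d u n x ≤ C * harm G d u n y

/-- Assumption 1(ii): for every `p ∈ (p_c(G), 1)` the in-ball connection probabilities
`b_n(·,u)` on the spheres `∂B_G(u,n)` are roughly uniform, with constants depending only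
on `p`. -/
def Assumption1ii (G : SimpleGraph V) : Prop :=
  ∀ p : ℝ, pc G < p → p < 1 →
    ∃ c₁ c₂ : ℝ, 0 < c₁ ∧ 0 < c₂ ∧ ∀ (u : V) (n : ℕ), 1 ≤ n → ∀ x y : V,
      onSphere G u n x → onSphere G u n y →
        c₁ * bconn G p u n y ≤ bconn G p u n x ∧ bconn G p u n x ≤ c₂ * bconn G p u n y

section Bernoulli

variable {α : Type*}

/-- Expectation of `f` under Bernoulli(`p`) percolation on the finite set `E`. -/
noncomputable def bexp (p : ℝ) (E : Finset α) (f : Finset α → ℝ) : ℝ :=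
  ∑ S ∈ E.powerset, p ^ S.card * (1 - p) ^ (E.card - S.card) * f S

/-- `f` depends only on the elements satisfying `P`. -/
def DepOn {β : Type*} (P : α → Prop) (f : Finset α → β) : Prop :=
  ∀ S T : Finset α, (∀ e, P e → (e ∈ S ↔ e ∈ T)) → f S = f T

lemma bexp_congr {p : ℝ} {E : Finset α} {f g : Finset α → ℝ} (h : ∀ S ⊆ E, f S = g S) :
    bexp p E f = bexp p E g :=
  Finset.sum_congr rfl fun S hS => by rw [h S (Finset.mem_powerset.1 hS)]

lemma bexp_mono {p : ℝ} (h0 : 0 ≤ p) (h1 : p ≤ 1) {E : Finset α} {f g : Finset α → ℝ}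
    (h : ∀ S ⊆ E, f S ≤ g S) : bexp p E f ≤ bexp p E g :=
  Finset.sum_le_sum fun S hS => mul_le_mul_of_nonneg_left (h S (Finset.mem_powerset.1 hS))
    (mul_nonneg (pow_nonneg h0 _) (pow_nonneg (by linarith) _))

lemma bexp_add (p : ℝ) (E : Finset α) (f g : Finset α → ℝ) :
    bexp p E (fun S => f S + g S) = bexp p E f + bexp p E g := by
  simp only [bexp, mul_add, Finset.sum_add_distrib]

lemma bexp_const_mul (p : ℝ) (E : Finset α) (c : ℝ) (f : Finset α → ℝ) :
    bexp p E (fun S => c * f S) = c * bexp p E f := by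
  simp only [bexp, Finset.mul_sum]
  exact Finset.sum_congr rfl fun S _ => by ring

lemma bexp_neg (p : ℝ) (E : Finset α) (f : Finset α → ℝ) :
    bexp p E (fun S => - f S) = - bexp p E f := by
  simp only [bexp, mul_neg, Finset.sum_neg_distrib]

lemma bexp_sub (p : ℝ) (E : Finset α) (f g : Finset α → ℝ) :
    bexp p E (fun S => f S - g S) = bexp p E f - bexp p E g := by
  simp only [bexp, mul_sub, Finset.sum_sub_distrib]

lemma bexp_sum {ι : Type*} (p : ℝ) (E : Finset α) (s : Finset ι) (f : ι → Finset α → ℝ) :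
    bexp p E (fun S => ∑ i ∈ s, f i S) = ∑ i ∈ s, bexp p E (f i) := by
  simp only [bexp, Finset.mul_sum]
  exact Finset.sum_comm

lemma bexp_empty (p : ℝ) (f : Finset α → ℝ) : bexp p ∅ f = f ∅ := by
  simp [bexp]

variable [DecidableEq α]

lemma bexp_insert (p : ℝ) {E : Finset α} {e : α} (he : e ∉ E) (f : Finset α → ℝ) :
    bexp p (insert e E) f
      = p * bexp p E (fun S => f (insert e S)) + (1 - p) * bexp p E f := by
  unfold bexp
  rw [Finset.sum_powerset_insert he, add_comm, Finset.mul_sum, Finset.mul_sum]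
  congr 1
  · refine Finset.sum_congr rfl fun S hS => ?_
    have hS' : e ∉ S := fun h => he (Finset.mem_powerset.1 hS h)
    rw [Finset.card_insert_of_notMem hS', Finset.card_insert_of_notMem he,
      Nat.add_sub_add_right]
    ring
  · refine Finset.sum_congr rfl fun S hS => ?_
    have hc := Finset.card_le_card (Finset.mem_powerset.1 hS)
    rw [Finset.card_insert_of_notMem he, Nat.sub_add_comm hc]
    ring

lemma bexp_const (p : ℝ) (E : Finset α) (c : ℝ) : bexp p E (fun _ => c) = c := by
  induction E using Finset.induction_on with
  | empty => exact bexp_empty _ _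
  | insert e E he ih => rw [bexp_insert p he, ih]; ring

lemma bexp_nonneg {p : ℝ} (h0 : 0 ≤ p) (h1 : p ≤ 1) {E : Finset α} {f : Finset α → ℝ}
    (h : ∀ S, 0 ≤ f S) : 0 ≤ bexp p E f := by
  have := bexp_mono h0 h1 (E := E) (f := fun _ => 0) (g := f) fun S _ => h S
  rwa [bexp_const] at this

lemma bexp_le_one {p : ℝ} (h0 : 0 ≤ p) (h1 : p ≤ 1) {E : Finset α} {f : Finset α → ℝ}
    (h : ∀ S, f S ≤ 1) : bexp p E f ≤ 1 := by
  have := bexp_mono h0 h1 (E := E) (f := f) (g := fun _ => 1) fun S _ => h S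
  rwa [bexp_const] at this

lemma bexp_one (E : Finset α) (f : Finset α → ℝ) : bexp 1 E f = f E := by
  induction E using Finset.induction_on generalizing f with
  | empty => exact bexp_empty _ _
  | insert e E he ih => rw [bexp_insert 1 he, ih]; ring

lemma bexp_mono_param {p q : ℝ} (h0 : 0 ≤ p) (hpq : p ≤ q) (h1 : q ≤ 1) (E : Finset α)
    {f : Finset α → ℝ} (hf : Monotone f) : bexp p E f ≤ bexp q E f := by
  induction E using Finset.induction_on generalizing f with
  | empty => simp [bexp_empty]
  | insert e E he ih =>
    rw [bexp_insert p he, bexp_insert q he]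
    have hm : Monotone (fun S => f (insert e S)) :=
      fun S T h => hf (Finset.insert_subset_insert e h)
    have h2 := ih hm
    have h3 := ih hf
    have h4 : bexp p E f ≤ bexp p E (fun S => f (insert e S)) :=
      bexp_mono h0 (hpq.trans h1) fun S _ => hf (Finset.subset_insert e S)
    nlinarith [mul_le_mul_of_nonneg_left h2 (h0.trans hpq),
      mul_le_mul_of_nonneg_left h3 (sub_nonneg.2 h1), mul_nonneg (sub_nonneg.2 hpq)
        (sub_nonneg.2 h4)]

lemma bexp_mul_of_depOn (p : ℝ) (E : Finset α) (P : α → Prop) {f g : Finset α → ℝ}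
    (hf : DepOn P f) (hg : DepOn (fun e => ¬ P e) g) :
    bexp p E (fun S => f S * g S) = bexp p E f * bexp p E g := by
  induction E using Finset.induction_on generalizing f g with
  | empty => simp [bexp_empty]
  | insert e E he ih =>
    have hf' : DepOn P (fun S => f (insert e S)) := fun S T h => hf _ _ fun a ha => by
      simp [h a ha]
    have hg' : DepOn (fun a => ¬ P a) (fun S => g (insert e S)) := fun S T h =>
      hg _ _ fun a ha => by simp [h a ha]
    rw [bexp_insert p he, bexp_insert p he, bexp_insert p he, ih hf' hg', ih hf hg]
    by_cases hP : P e
    · have : (fun S => g (insert e S)) = g := by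
        funext S
        refine hg _ _ fun a ha => ?_
        have : a ≠ e := by rintro rfl; exact ha hP
        simp [this]
      rw [this]; ring
    · have : (fun S => f (insert e S)) = f := by
        funext S
        refine hf _ _ fun a ha => ?_
        have : a ≠ e := by rintro rfl; exact hP ha
        simp [this]
      rw [this]; ring

lemma bexp_mem (p : ℝ) {E : Finset α} {e : α} (he : e ∈ E) :
    bexp p E (fun S => if e ∈ S then 1 else 0) = p := by
  obtain ⟨E', h', rfl⟩ : ∃ E', e ∉ E' ∧ insert e E' = E :=
    ⟨E.erase e, Finset.notMem_erase e E, Finset.insert_erase he⟩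
  rw [bexp_insert p h']
  have : bexp p E' (fun S => if e ∈ S then (1 : ℝ) else 0) = 0 := by
    rw [bexp_congr (g := fun _ => 0) fun S hS => if_neg fun h => h' (hS h), bexp_const]
  simp [this, bexp_const]

/-- Forcing one edge open costs at most a factor `p`. -/
lemma mul_bexp_le_of_mem {p : ℝ} (h0 : 0 ≤ p) (h1 : p ≤ 1) {E : Finset α} {e : α} (he : e ∈ E)
    {f g : Finset α → ℝ} (hf : ∀ S, 0 ≤ f S) (hg : Monotone g)
    (hfg : ∀ S, e ∈ S → g S ≤ f S) : p * bexp p E g ≤ bexp p E f := by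
  obtain ⟨E', h', rfl⟩ : ∃ E', e ∉ E' ∧ insert e E' = E :=
    ⟨E.erase e, Finset.notMem_erase e E, Finset.insert_erase he⟩
  rw [bexp_insert p h', bexp_insert p h']
  have a1 : bexp p E' (fun S => g (insert e S)) ≤ bexp p E' (fun S => f (insert e S)) :=
    bexp_mono h0 h1 fun S _ => hfg _ (Finset.mem_insert_self e S)
  have a2 : bexp p E' g ≤ bexp p E' (fun S => g (insert e S)) :=
    bexp_mono h0 h1 fun S _ => hg (Finset.subset_insert e S)
  have a3 : 0 ≤ bexp p E' f := bexp_nonneg h0 h1 hf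
  have a4 := mul_le_mul_of_nonneg_left a2 (sub_nonneg.2 h1)
  calc _ ≤ p * bexp p E' (fun S => g (insert e S)) :=
        mul_le_mul_of_nonneg_left (by linarith) h0
    _ ≤ p * bexp p E' (fun S => f (insert e S)) := mul_le_mul_of_nonneg_left a1 h0
    _ ≤ _ := le_add_of_nonneg_right (mul_nonneg (by linarith) a3)


lemma bexp_inter_of_depOn (p : ℝ) (E F : Finset α) {g : Finset α → ℝ} (hg : DepOn (· ∈ F) g) :
    bexp p E g = bexp p (E ∩ F) g := by
  induction E using Finset.induction_on generalizing g with
  | empty => simp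
  | insert e E he ih =>
    rw [bexp_insert p he]
    by_cases hF : e ∈ F
    · have hg' : DepOn (· ∈ F) (fun S => g (insert e S)) := fun S T h =>
        hg _ _ fun a ha => by simp [h a ha]
      rw [Finset.insert_inter_of_mem hF, bexp_insert p (fun h => he (Finset.mem_inter.1 h).1),
        ih hg', ih hg]
    · have : (fun S => g (insert e S)) = g := by
        funext S
        refine hg _ _ fun a ha => ?_
        have : a ≠ e := by rintro rfl; exact hF ha
        simp [this]
      rw [Finset.insert_inter_of_notMem hF, this, ← ih hg]; ring

lemma bexp_eq_of_depOn (p : ℝ) {E F : Finset α} (hEF : F ⊆ E) {g : Finset α → ℝ}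
    (hg : DepOn (· ∈ F) g) : bexp p E g = bexp p F g := by
  rw [bexp_inter_of_depOn p E F hg, Finset.inter_eq_right.2 hEF]

lemma bexp_mono_set {p : ℝ} (h0 : 0 ≤ p) (h1 : p ≤ 1) {E F : Finset α} (hEF : E ⊆ F)
    {g : Finset α → ℝ} (hg : Monotone g) : bexp p E g ≤ bexp p F g := by
  have key : ∀ D : Finset α, bexp p E g ≤ bexp p (E ∪ D) g := by
    intro D
    induction D using Finset.induction_on with
    | empty => simp
    | insert e D _ ih =>
      rw [Finset.union_insert]
      by_cases he : e ∈ E ∪ D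
      · rwa [Finset.insert_eq_self.2 he]
      · rw [bexp_insert p he]
        have : bexp p (E ∪ D) g ≤ bexp p (E ∪ D) (fun S => g (insert e S)) :=
          bexp_mono h0 h1 fun S _ => hg (Finset.subset_insert e S)
        nlinarith [mul_le_mul_of_nonneg_left this h0]
  simpa [Finset.union_eq_right.2 hEF] using key F

/-- A monotone function determined by the state of `F` has its largest expectation on `F`. -/
lemma bexp_le_of_le {p : ℝ} (h0 : 0 ≤ p) (h1 : p ≤ 1) (E F : Finset α)
    {f g : Finset α → ℝ} (hgm : Monotone g) (hg : DepOn (· ∈ F) g) (hfg : ∀ S, f S ≤ g S) :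
    bexp p E f ≤ bexp p F g := by
  refine (bexp_mono h0 h1 fun S _ => hfg S).trans ?_
  rw [bexp_inter_of_depOn p E F hg]
  exact bexp_mono_set h0 h1 Finset.inter_subset_right hgm

/-- Russo's formula for an observable that may itself depend on the parameter. -/
lemma hasDerivAt_bexp (E : Finset α) (F : ℝ → Finset α → ℝ) (F' : Finset α → ℝ) (p : ℝ)
    (h : ∀ S, HasDerivAt (fun q => F q S) (F' S) p) :
    HasDerivAt (fun q => bexp q E (F q))
      (bexp p E (fun S => ∑ e ∈ E, (F p (insert e S) - F p (S.erase e))) + bexp p E F') p := by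
  induction E using Finset.induction_on generalizing F F' with
  | empty => simpa [bexp_empty] using h ∅
  | insert a E ha ih =>
    have i1 := ih (fun q S => F q (insert a S)) (fun S => F' (insert a S)) fun S => h _
    have i0 := ih F F' h
    have hd := ((hasDerivAt_id p).mul i1).add (((hasDerivAt_id p).const_sub 1).mul i0)
    have e1 : bexp p E (fun S => ∑ e ∈ insert a E,
          (F p (insert e (insert a S)) - F p ((insert a S).erase e)))
        = bexp p E (fun S => F p (insert a S)) - bexp p E (F p)
          + bexp p E (fun S => ∑ e ∈ E, (F p (insert a (insert e S))
              - F p (insert a (S.erase e)))) := by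
      rw [← bexp_sub, ← bexp_add]
      refine bexp_congr fun S hS => ?_
      rw [Finset.sum_insert ha, Finset.insert_idem,
        Finset.erase_insert (fun h => ha (hS h))]
      congr 1
      refine Finset.sum_congr rfl fun e he => ?_
      have hne : a ≠ e := by rintro rfl; exact ha he
      rw [Finset.insert_comm, Finset.erase_insert_of_ne hne]
    have e0 : bexp p E (fun S => ∑ e ∈ insert a E, (F p (insert e S) - F p (S.erase e)))
        = bexp p E (fun S => F p (insert a S)) - bexp p E (F p)
          + bexp p E (fun S => ∑ e ∈ E, (F p (insert e S) - F p (S.erase e))) := by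
      rw [← bexp_sub, ← bexp_add]
      refine bexp_congr fun S hS => ?_
      rw [Finset.sum_insert ha, Finset.erase_eq_of_notMem (fun h => ha (hS h))]
    refine (hd.congr_deriv ?_).congr_of_eventuallyEq ?_
    · rw [bexp_insert p ha, bexp_insert p ha, e1, e0]
      simp only [id]
      ring
    · exact Filter.Eventually.of_forall fun q => by
        simp [bexp_insert q ha]

open scoped Classical in
lemma cylProb_eq_bexp (p : ℝ) {V : Type*} (E : Finset (Sym2 V)) (A : Finset (Sym2 V) → Prop) :
    cylProb p E A = bexp p E (fun S => if A S then 1 else 0) := by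
  unfold cylProb bexp
  refine Finset.sum_congr rfl fun S _ => ?_
  by_cases h : A S <;> simp [h]

end Bernoulli

section Clusters

open scoped Classical

variable {G : SimpleGraph V}

/-- The graph of open edges. -/
def opn (G : SimpleGraph V) (S : Finset (Sym2 V)) : SimpleGraph V where
  Adj a b := G.Adj a b ∧ s(a, b) ∈ S
  symm := ⟨fun a b h => ⟨h.1.symm, by rw [Sym2.eq_swap]; exact h.2⟩⟩
  loopless := ⟨fun a h => G.loopless.irrefl a h.1⟩

/-- The open cluster of `x`. -/
def cl (G : SimpleGraph V) (S : Finset (Sym2 V)) (x : V) : Set V :=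
  {y | (opn G S).Reachable x y}

lemma self_mem_cl (S : Finset (Sym2 V)) (x : V) : x ∈ cl G S x :=
  SimpleGraph.Reachable.refl x

lemma mem_cl_step {S : Finset (Sym2 V)} {x a b : V} (ha : a ∈ cl G S x) (hab : G.Adj a b)
    (hS : s(a, b) ∈ S) : b ∈ cl G S x :=
  SimpleGraph.Reachable.trans ha (SimpleGraph.Adj.reachable (G := opn G S) ⟨hab, hS⟩)

lemma cl_subset_of_closed {S : Finset (Sym2 V)} {x : V} {K : Set V} (hx : x ∈ K)
    (hK : ∀ a ∈ K, ∀ b, a ∈ cl G S x → G.Adj a b → s(a, b) ∈ S → b ∈ K) : cl G S x ⊆ K := by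
  intro y hy
  have hy' : Relation.ReflTransGen (opn G S).Adj x y :=
    (SimpleGraph.reachable_iff_reflTransGen x y).1 hy
  suffices h : y ∈ K ∧ y ∈ cl G S x from h.1
  induction hy' with
  | refl => exact ⟨hx, self_mem_cl S x⟩
  | tail _ h2 ih =>
    obtain ⟨h3, h4⟩ := ih ((SimpleGraph.reachable_iff_reflTransGen _ _).2 ‹_›)
    exact ⟨hK _ h3 _ h4 h2.1 h2.2, hy⟩

lemma cl_mono {S T : Finset (Sym2 V)} (h : S ⊆ T) (x : V) : cl G S x ⊆ cl G T x :=
  cl_subset_of_closed (self_mem_cl T x) fun _ ha _ _ hab hS => mem_cl_step ha hab (h hS)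

lemma mem_cl_symm {S : Finset (Sym2 V)} {x y : V} (h : y ∈ cl G S x) : x ∈ cl G S y :=
  SimpleGraph.Reachable.symm h

lemma mem_cl_trans {S : Finset (Sym2 V)} {x y z : V} (h : y ∈ cl G S x) (h' : z ∈ cl G S y) :
    z ∈ cl G S x :=
  SimpleGraph.Reachable.trans h h'

lemma cl_eq_of_mem {S : Finset (Sym2 V)} {x y : V} (h : y ∈ cl G S x) : cl G S y = cl G S x :=
  Set.Subset.antisymm (fun _ hz => mem_cl_trans h hz)
    (fun _ hz => mem_cl_trans (mem_cl_symm h) hz)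

lemma connectedVia_iff {S : Finset (Sym2 V)} {x y : V} :
    connectedVia G S x y ↔ y ∈ cl G S x := by
  constructor
  · rintro ⟨w, hw⟩
    induction w with
    | nil => exact self_mem_cl S _
    | cons h w ih =>
      simp only [SimpleGraph.Walk.edges_cons, List.mem_cons, forall_eq_or_imp] at hw
      exact mem_cl_trans (mem_cl_step (self_mem_cl S _) h hw.1) (ih hw.2)
  · intro h
    refine cl_subset_of_closed (K := {y | connectedVia G S x y})
      ⟨SimpleGraph.Walk.nil, by simp⟩ ?_ h
    rintro a ⟨w, hw⟩ b - hab hS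
    refine ⟨w.concat hab, fun e he => ?_⟩
    simp only [SimpleGraph.Walk.edges_concat, List.concat_eq_append, List.mem_append,
      List.mem_singleton] at he
    rcases he with he | rfl
    · exact hw e he
    · exact hS

lemma cl_congr {S T : Finset (Sym2 V)} {x : V}
    (h : ∀ a b, G.Adj a b → a ∈ cl G S x → (s(a, b) ∈ S ↔ s(a, b) ∈ T)) :
    cl G T x = cl G S x := by
  refine Set.Subset.antisymm ?_ ?_
  · exact cl_subset_of_closed (self_mem_cl S x) fun a ha b _ hab hT =>
      mem_cl_step ha hab ((h a b hab ha).2 hT)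
  · intro y hy
    refine cl_subset_of_closed (S := S) (K := cl G T x) (self_mem_cl T x) ?_ hy
    intro a ha b ha' hab hS
    exact mem_cl_step ha hab ((h a b hab ha').1 hS)

/-- The edge `e` has an endpoint in `I`. -/
def touch (I : Set V) (e : Sym2 V) : Prop := ∃ a ∈ I, a ∈ e

lemma touch_left {I : Set V} {a : V} (b : V) (ha : a ∈ I) : touch I s(a, b) :=
  ⟨a, ha, Sym2.mem_mk_left a b⟩

lemma touch_mk {I : Set V} {a b : V} : touch I s(a, b) ↔ a ∈ I ∨ b ∈ I := by
  constructor
  · rintro ⟨c, hc, h⟩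
    rcases Sym2.mem_iff.1 h with rfl | rfl
    · exact Or.inl hc
    · exact Or.inr hc
  · rintro (h | h)
    · exact ⟨a, h, Sym2.mem_mk_left a b⟩
    · exact ⟨b, h, Sym2.mem_mk_right a b⟩

/-- The configuration obtained by closing all edges touching `I`. -/
noncomputable def off (I : Set V) (S : Finset (Sym2 V)) : Finset (Sym2 V) :=
  S.filter fun e => ¬ touch I e

lemma mem_off {I : Set V} {S : Finset (Sym2 V)} {e : Sym2 V} :
    e ∈ off I S ↔ e ∈ S ∧ ¬ touch I e := by simp [off]

lemma off_subset (I : Set V) (S : Finset (Sym2 V)) : off I S ⊆ S := Finset.filter_subset _ _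

lemma off_mono (I : Set V) : Monotone (off I) := fun _ _ h =>
  Finset.filter_subset_filter _ h

lemma cl_eq_iff_of_agree {I : Set V} {S T : Finset (Sym2 V)}
    (h : ∀ e, touch I e → (e ∈ S ↔ e ∈ T)) (x : V) : cl G S x = I ↔ cl G T x = I := by
  constructor
  · rintro hI
    rw [← hI]
    exact cl_congr fun a b _ ha => h _ (touch_left b (hI ▸ ha))
  · rintro hI
    rw [← hI]
    exact cl_congr fun a b _ ha => (h _ (touch_left b (hI ▸ ha))).symm

lemma cl_subset_iff_of_agree {I : Set V} {S T : Finset (Sym2 V)}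
    (h : ∀ e ∈ G.edgeSet, touch I e → (e ∈ S ↔ e ∈ T)) (x : V) :
    cl G S x ⊆ I ↔ cl G T x ⊆ I := by
  constructor
  · rintro hI
    rw [cl_congr (S := S) (T := T) fun a b hab ha => h _ hab (touch_left b (hI ha))]
    exact hI
  · rintro hI
    rw [cl_congr (S := T) (T := S) fun a b hab ha => (h _ hab (touch_left b (hI ha))).symm]
    exact hI

/-- Outside the cluster of `o`, edges touching that cluster are irrelevant. -/
lemma cl_off_of_cl_eq {I : Set V} {S : Finset (Sym2 V)} {o z : V} (hI : cl G S o = I)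
    (hz : z ∉ I) : cl G (off I S) z = cl G S z := by
  have hdis : ∀ a ∈ cl G S z, a ∉ I := fun a ha haI =>
    hz (hI ▸ mem_cl_trans (hI.symm ▸ haI : a ∈ cl G S o) (mem_cl_symm ha))
  refine cl_congr fun a b hab ha => ?_
  rw [mem_off, iff_self_and]
  intro hS ht
  rcases touch_mk.1 ht with h | h
  · exact hdis a ha h
  · exact hdis b (mem_cl_step ha hab hS) h

lemma cl_union_subset_insert {S : Finset (Sym2 V)} {o x z : V} (hx : x ∈ cl G S o)
    (hxz : G.Adj x z) : cl G S o ∪ cl G S z ⊆ cl G (insert s(x, z) S) o := by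
  have hsub : S ⊆ insert s(x, z) S := Finset.subset_insert _ _
  rintro y (hy | hy)
  · exact cl_mono hsub o hy
  · exact mem_cl_trans (mem_cl_step (cl_mono hsub o hx) hxz (Finset.mem_insert_self _ _))
      (cl_mono hsub z hy)

end Clusters

section Neighbourhoods

open scoped Classical

variable {G : SimpleGraph V} (hlf : ∀ v, (G.neighborSet v).Finite)

lemma finite_touching (hlf : ∀ v, (G.neighborSet v).Finite) (Ω : Finset V) :
    {e : Sym2 V | e ∈ G.edgeSet ∧ touch (Ω : Set V) e}.Finite := by
  refine Set.Finite.subset (Ω.finite_toSet.biUnion fun a _ =>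
    (hlf a).image fun b => s(a, b)) ?_
  rintro e ⟨he, a, ha, hae⟩
  obtain ⟨b, rfl⟩ := Sym2.mem_iff_exists.1 hae
  exact Set.mem_biUnion ha ⟨b, he, rfl⟩

/-- The finite set of edges of `G` touching `Ω`. -/
noncomputable def tE (Ω : Finset V) : Finset (Sym2 V) := (finite_touching hlf Ω).toFinset

lemma mem_tE {Ω : Finset V} {e : Sym2 V} :
    e ∈ tE hlf Ω ↔ e ∈ G.edgeSet ∧ touch (Ω : Set V) e := by simp [tE]

/-- The outer vertex boundary of `I`. -/
noncomputable def bd (I : Finset V) : Finset V := (I.biUnion fun a => (hlf a).toFinset) \ I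

lemma mem_bd {I : Finset V} {y : V} : y ∈ bd hlf I ↔ (∃ a ∈ I, G.Adj a y) ∧ y ∉ I := by
  simp [bd]

/-- The `k`-neighbourhood of `I`. -/
noncomputable def nbh (I : Finset V) : ℕ → Finset V
  | 0 => I
  | k + 1 => nbh I k ∪ bd hlf (nbh I k)

lemma mem_nbh_succ {I : Finset V} {k : ℕ} {y : V} :
    y ∈ nbh hlf I (k + 1) ↔ y ∈ nbh hlf I k ∨ ∃ a ∈ nbh hlf I k, G.Adj a y := by
  simp only [nbh, Finset.mem_union, mem_bd]
  tauto

lemma nbh_mono (I : Finset V) {k l : ℕ} (h : k ≤ l) : nbh hlf I k ⊆ nbh hlf I l := by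
  induction l, h using Nat.le_induction with
  | base => exact le_rfl
  | succ l _ ih => exact ih.trans Finset.subset_union_left

lemma mem_nbh_singleton {v x : V} {n : ℕ} : x ∈ nbh hlf {v} n ↔ inBall G v n x := by
  induction n generalizing x with
  | zero =>
    simp only [nbh, Finset.mem_singleton, inBall]
    constructor
    · rintro rfl
      exact ⟨SimpleGraph.Walk.nil, by simp⟩
    · rintro ⟨w, hw⟩
      exact (SimpleGraph.Walk.eq_of_length_eq_zero (Nat.le_zero.1 hw)).symm
  | succ n ih =>
    rw [mem_nbh_succ]
    constructor
    · rintro (h | ⟨a, ha, hay⟩)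
      · obtain ⟨w, hw⟩ := ih.1 h
        exact ⟨w, hw.trans (Nat.le_succ n)⟩
      · obtain ⟨w, hw⟩ := ih.1 ha
        exact ⟨w.concat hay, by simpa using hw⟩
    · rintro ⟨w, hw⟩
      cases hr : w.reverse with
      | nil =>
        left
        exact ih.2 ⟨SimpleGraph.Walk.nil, by simp⟩
      | cons h w' =>
        right
        have hl : w.length = w'.length + 1 := by
          rw [← SimpleGraph.Walk.length_reverse, hr, SimpleGraph.Walk.length_cons]
        exact ⟨_, ih.2 ⟨w'.reverse, by rw [SimpleGraph.Walk.length_reverse]; omega⟩, h.symm⟩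

lemma card_bd_le {d : ℕ} (hreg : ∀ v, (G.neighborSet v).ncard = d) (I : Finset V) :
    (bd hlf I).card ≤ d * I.card := by
  refine (Finset.card_le_card Finset.sdiff_subset).trans ?_
  rw [mul_comm]
  refine Finset.card_biUnion_le_card_mul _ _ _ fun a _ => ?_
  rw [← Set.ncard_eq_toFinset_card _ (hlf a), hreg]

lemma card_nbh_le {d : ℕ} (hreg : ∀ v, (G.neighborSet v).ncard = d) (z : V) (k : ℕ) :
    (nbh hlf {z} k).card ≤ (d + 1) ^ k := by
  induction k with
  | zero => simp [nbh]
  | succ k ih =>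
    calc _ ≤ (nbh hlf {z} k).card + (bd hlf (nbh hlf {z} k)).card := Finset.card_union_le _ _
      _ ≤ (nbh hlf {z} k).card + d * (nbh hlf {z} k).card := by
        gcongr; exact card_bd_le hlf hreg _
      _ = (nbh hlf {z} k).card * (d + 1) := by ring
      _ ≤ (d + 1) ^ (k + 1) := by rw [pow_succ]; gcongr

lemma le_card_nbh {c : ℝ} (hc : 0 ≤ c)
    (hexp : ∀ I : Finset V, c * (I.card : ℝ) ≤ ((bd hlf I).card : ℝ)) (I : Finset V) (k : ℕ) :
    (1 + c) ^ k * (I.card : ℝ) ≤ ((nbh hlf I k).card : ℝ) := by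
  induction k with
  | zero => simp [nbh]
  | succ k ih =>
    have hdis : Disjoint (nbh hlf I k) (bd hlf (nbh hlf I k)) := by
      unfold bd; exact Finset.disjoint_sdiff
    rw [nbh, Finset.card_union_of_disjoint hdis, Nat.cast_add]
    have := hexp (nbh hlf I k)
    calc (1 + c) ^ (k + 1) * (I.card : ℝ) = (1 + c) * ((1 + c) ^ k * I.card) := by ring
      _ ≤ (1 + c) * (nbh hlf I k).card := by gcongr
      _ ≤ _ := by linarith

end Neighbourhoods

section Expansion

open scoped Classical

variable {G : SimpleGraph V} (hlf : ∀ v, (G.neighborSet v).Finite)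

lemma tsum_subtype_finite {s : Set V} (hs : s.Finite) (f : V → ℝ) :
    ∑' y : s, f (y : V) = ∑ y ∈ hs.toFinset, f y := by
  have := hs.fintype
  rw [tsum_fintype, Finset.sum_subtype hs.toFinset (p := (· ∈ s)) (by simp) f]

lemma le_of_pos_of_le_sInf {s : Set ℝ} {c r : ℝ} (hc : 0 < c) (h : c ≤ sInf s) (hr : r ∈ s) :
    c ≤ r := by
  by_cases hb : BddBelow s
  · exact h.trans (csInf_le hb hr)
  · rw [Real.sInf_of_not_bddBelow hb] at h
    exact absurd h (not_le.2 hc)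

lemma sum_boundary_le {d : ℕ} (hreg : ∀ v, (G.neighborSet v).ncard = d) (I : Finset V) :
    ∑ x ∈ I, ((d : ℝ) - ∑ y ∈ (hlf x).toFinset, if y ∈ I then (1 : ℝ) else 0)
      ≤ d * ((bd hlf I).card : ℝ) := by
  have hcard : ∀ x, ((hlf x).toFinset.card : ℝ) = d := fun x => by
    rw [← Set.ncard_eq_toFinset_card _ (hlf x), hreg]
  have h1 : ∀ x ∈ I, ((d : ℝ) - ∑ y ∈ (hlf x).toFinset, if y ∈ I then (1 : ℝ) else 0)
      = ∑ y ∈ bd hlf I, if G.Adj x y then (1 : ℝ) else 0 := by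
    intro x hx
    have : (d : ℝ) = ∑ y ∈ (hlf x).toFinset, (1 : ℝ) := by simp [hcard x]
    rw [this, ← Finset.sum_sub_distrib, ← Finset.sum_filter]
    have h2 : ∀ y ∈ (hlf x).toFinset, (1 : ℝ) - (if y ∈ I then 1 else 0)
        = if y ∉ I then 1 else 0 := fun y _ => by by_cases h : y ∈ I <;> simp [h]
    rw [Finset.sum_congr rfl h2, ← Finset.sum_filter]
    refine Finset.sum_congr ?_ fun _ _ => rfl
    ext y
    simp only [Finset.mem_filter, Set.Finite.mem_toFinset, SimpleGraph.mem_neighborSet, mem_bd]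
    exact ⟨fun h => ⟨⟨⟨x, hx, h.1⟩, h.2⟩, h.1⟩, fun h => ⟨h.2, h.1.2⟩⟩
  rw [Finset.sum_congr rfl h1, Finset.sum_comm, mul_comm, ← nsmul_eq_mul]
  refine Finset.sum_le_card_nsmul _ _ _ fun y _ => ?_
  rw [← hcard y, ← Finset.sum_filter, Finset.sum_const, nsmul_eq_mul, mul_one]
  exact_mod_cast Finset.card_le_card fun x hx => by
    simpa using (Finset.mem_filter.1 hx).2.symm

/-- A spectral gap forces vertex expansion. -/
lemma expansion_of_le_lambda1 {d : ℕ} (hreg : ∀ v, (G.neighborSet v).ncard = d) {c : ℝ}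
    (hc : 0 < c) (hl : c ≤ lambda1 G) (I : Finset V) :
    c * (I.card : ℝ) ≤ ((bd hlf I).card : ℝ) := by
  rcases I.eq_empty_or_nonempty with rfl | hI
  · simp
  let f : V →₀ ℝ := Finsupp.onFinset I (fun x => if x ∈ I then 1 else 0) (by
    intro a ha; by_contra h; simp [h] at ha)
  have hf : ∀ x, f x = if x ∈ I then 1 else 0 := fun _ => rfl
  have hsupp : f.support = I := by
    ext x; simp [hf]
  have hne : f ≠ 0 := by
    rintro h
    rw [h, Finsupp.support_zero] at hsupp
    exact hI.ne_empty hsupp.symm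
  have hIc : (0 : ℝ) < I.card := by exact_mod_cast hI.card_pos
  have hle := le_of_pos_of_le_sInf hc hl ⟨f, hne, rfl⟩
  rw [hsupp] at hle
  have hden : ∑ x ∈ I, ((G.neighborSet x).ncard : ℝ) * f x ^ 2 = d * I.card := by
    rw [Finset.sum_congr rfl (g := fun _ => (d : ℝ)) fun x hx => by simp [hf, hx, hreg]]
    simp [mul_comm]
  have hnum : ∑ x ∈ I, (((G.neighborSet x).ncard : ℝ) * f x
      - ∑' y : G.neighborSet x, f (y : V)) * f x
      = ∑ x ∈ I, ((d : ℝ) - ∑ y ∈ (hlf x).toFinset, if y ∈ I then (1 : ℝ) else 0) := by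
    refine Finset.sum_congr rfl fun x hx => ?_
    rw [tsum_subtype_finite (hlf x) f, hreg, hf x, if_pos hx]
    simp only [hf, mul_one]
  rw [hden, hnum] at hle
  have hd : (0 : ℝ) < d := by
    rcases Nat.eq_zero_or_pos d with rfl | h
    · simp at hle; linarith
    · exact_mod_cast h
  rw [le_div_iff₀ (by positivity)] at hle
  have := hle.trans (sum_boundary_le hlf hreg I)
  nlinarith

end Expansion

section Exit

open scoped Classical

variable {G : SimpleGraph V} (hlf : ∀ v, (G.neighborSet v).Finite)

/-- The probability that the cluster of `v` is not contained in the finite set `Ω`. -/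
noncomputable def ex (p : ℝ) (Ω : Finset V) (v : V) : ℝ :=
  bexp p (tE hlf Ω) fun S => if cl G S v ⊆ Ω then 0 else 1

lemma exit_monotone (Ω : Set V) (v : V) :
    Monotone fun S : Finset (Sym2 V) => if cl G S v ⊆ Ω then (0 : ℝ) else 1 := by
  intro S T h
  have := cl_mono (G := G) h v
  by_cases hT : cl G T v ⊆ Ω
  · simp [hT, this.trans hT]
  · by_cases hS : cl G S v ⊆ Ω <;> simp [hT, hS]

lemma exit_depOn (Ω : Finset V) (v : V) :
    DepOn (· ∈ tE hlf Ω)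
      fun S : Finset (Sym2 V) => if cl G S v ⊆ Ω then (0 : ℝ) else 1 := by
  intro S T h
  have := cl_subset_iff_of_agree (G := G) (I := (Ω : Set V)) (S := S) (T := T)
    (fun e he ht => h e ((mem_tE hlf).2 ⟨he, ht⟩)) v
  simp only [this]

lemma ex_nonneg {p : ℝ} (h0 : 0 ≤ p) (h1 : p ≤ 1) (Ω : Finset V) (v : V) : 0 ≤ ex hlf p Ω v :=
  bexp_nonneg h0 h1 fun S => by split_ifs <;> norm_num

lemma ex_le_one {p : ℝ} (h0 : 0 ≤ p) (h1 : p ≤ 1) (Ω : Finset V) (v : V) : ex hlf p Ω v ≤ 1 :=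
  bexp_le_one h0 h1 fun S => by split_ifs <;> norm_num

lemma ex_mono {p q : ℝ} (h0 : 0 ≤ p) (hpq : p ≤ q) (h1 : q ≤ 1) (Ω : Finset V) (v : V) :
    ex hlf p Ω v ≤ ex hlf q Ω v :=
  bexp_mono_param h0 hpq h1 _ (exit_monotone _ v)

lemma ex_anti {p : ℝ} (h0 : 0 ≤ p) (h1 : p ≤ 1) {Ω Ω' : Finset V} (h : Ω ⊆ Ω') (v : V) :
    ex hlf p Ω' v ≤ ex hlf p Ω v := by
  refine bexp_le_of_le h0 h1 _ _ (exit_monotone _ v) (exit_depOn hlf Ω v) fun S => ?_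
  by_cases hS : cl G S v ⊆ Ω
  · have : cl G S v ⊆ Ω' := hS.trans (by exact_mod_cast h)
    simp [hS, this]
  · by_cases hS' : cl G S v ⊆ Ω' <;> simp [hS, hS']

lemma prob_reach_eq {p : ℝ} (h0 : 0 ≤ p) (h1 : p ≤ 1) (v : V) (n : ℕ) :
    prob p (fun S => ∃ x : V, ¬ inBall G v n x ∧ connectedVia G S v x)
      = ex hlf p (nbh hlf {v} n) v := by
  have key : ∀ S : Finset (Sym2 V),
      (if ∃ x : V, ¬ inBall G v n x ∧ connectedVia G S v x then (1 : ℝ) else 0)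
        = if cl G S v ⊆ nbh hlf {v} n then 0 else 1 := by
    intro S
    have : (∃ x : V, ¬ inBall G v n x ∧ connectedVia G S v x) ↔ ¬ cl G S v ⊆ nbh hlf {v} n := by
      rw [Set.not_subset]
      simp only [connectedVia_iff, Finset.mem_coe, mem_nbh_singleton]
      exact exists_congr fun x => and_comm
    simp only [this, ite_not]
  have hle : ∀ E : Finset (Sym2 V),
      cylProb p E (fun S => ∃ x : V, ¬ inBall G v n x ∧ connectedVia G S v x)
        ≤ ex hlf p (nbh hlf {v} n) v := by
    intro E
    rw [cylProb_eq_bexp]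
    exact bexp_le_of_le h0 h1 _ _ (exit_monotone _ v) (exit_depOn hlf _ v)
      fun S => (key S).le
  refine le_antisymm (ciSup_le hle) ?_
  refine le_trans (le_of_eq ?_) (le_ciSup (⟨_, by rintro _ ⟨E, rfl⟩; exact hle E⟩ : BddAbove _)
    (tE hlf (nbh hlf {v} n)))
  rw [cylProb_eq_bexp]
  exact bexp_congr fun S _ => (key S).symm

lemma theta_eq {p : ℝ} (h0 : 0 ≤ p) (h1 : p ≤ 1) (v : V) :
    theta G p v = ⨅ n : ℕ, ex hlf p (nbh hlf {v} n) v := by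
  unfold theta
  simp only [prob_reach_eq hlf h0 h1]

lemma theta_le {p : ℝ} (h0 : 0 ≤ p) (h1 : p ≤ 1) (v : V) (n : ℕ) :
    theta G p v ≤ ex hlf p (nbh hlf {v} n) v := by
  rw [theta_eq hlf h0 h1]
  exact ciInf_le ⟨0, by rintro _ ⟨n, rfl⟩; exact ex_nonneg hlf h0 h1 _ _⟩ n

lemma le_theta {p : ℝ} (h0 : 0 ≤ p) (h1 : p ≤ 1) (v : V) {t : ℝ}
    (h : ∀ n, t ≤ ex hlf p (nbh hlf {v} n) v) : t ≤ theta G p v := by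
  rw [theta_eq hlf h0 h1]
  exact le_ciInf h

lemma theta_mono (hlf : ∀ v, (G.neighborSet v).Finite)
    {p q : ℝ} (h0 : 0 ≤ p) (hpq : p ≤ q) (h1 : q ≤ 1) (v : V) :
    theta G p v ≤ theta G q v :=
  le_theta hlf (h0.trans hpq) h1 v fun n =>
    (theta_le hlf h0 (hpq.trans h1) v n).trans (ex_mono hlf h0 hpq h1 _ _)

lemma theta_one_pos (hlf : ∀ v, (G.neighborSet v).Finite)
    (hconn : G.Connected) (hinf : Infinite V) (v : V) : 0 < theta G 1 v := by
  refine lt_of_lt_of_le one_pos (le_theta hlf zero_le_one le_rfl v fun n => ?_)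
  unfold ex
  rw [bexp_one, if_neg]
  intro hsub
  have hall : ∀ y, y ∈ cl G (tE hlf (nbh hlf {v} n)) v := by
    intro y
    have hy := (SimpleGraph.reachable_iff_reflTransGen v y).1 (hconn.preconnected v y)
    induction hy with
    | refl => exact self_mem_cl _ _
    | tail _ h2 ih =>
      exact mem_cl_step ih h2 ((mem_tE hlf).2 ⟨h2, touch_left _ (hsub ih)⟩)
  exact Set.infinite_univ ((nbh hlf {v} n).finite_toSet.subset fun y _ => hsub (hall y))

lemma pc_nonneg (G : SimpleGraph V) : 0 ≤ pc G := Real.sInf_nonneg fun _ hp => hp.1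

lemma pc_le_of_theta_pos {p : ℝ} (h0 : 0 ≤ p) (h1 : p ≤ 1) {v : V} (h : 0 < theta G p v) :
    pc G ≤ p :=
  csInf_le ⟨0, fun _ hp => hp.1⟩ ⟨h0, h1, v, h⟩

lemma pc_le_one (hlf : ∀ v, (G.neighborSet v).Finite)
    (hconn : G.Connected) (hinf : Infinite V) : pc G ≤ 1 :=
  pc_le_of_theta_pos zero_le_one le_rfl
    (theta_one_pos hlf hconn hinf (Classical.arbitrary V))

lemma exists_theta_pos_of_pc_lt (hlf : ∀ v, (G.neighborSet v).Finite)
    (hconn : G.Connected) (hinf : Infinite V) {p : ℝ}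
    (h : pc G < p) (h1 : p ≤ 1) : ∃ v, 0 < theta G p v := by
  have hne : {p : ℝ | 0 ≤ p ∧ p ≤ 1 ∧ ∃ v : V, 0 < theta G p v}.Nonempty :=
    ⟨1, zero_le_one, le_rfl, Classical.arbitrary V, theta_one_pos hlf hconn hinf _⟩
  obtain ⟨q, ⟨hq0, _, v, hv⟩, hqp⟩ := exists_lt_of_csInf_lt hne h
  exact ⟨v, hv.trans_le (theta_mono hlf hq0 hqp.le h1 v)⟩

end Exit

section LocalComparison

open scoped Classical

lemma bexp_image {α β : Type*} [DecidableEq α] [DecidableEq β] (p : ℝ) (m : α → β)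
    (E : Finset α) (hm : Set.InjOn m E) (g : Finset β → ℝ) :
    bexp p (E.image m) g = bexp p E fun S => g (S.image m) := by
  induction E using Finset.induction_on generalizing g with
  | empty => simp [bexp_empty]
  | insert e E he ih =>
    have hm' : Set.InjOn m E := hm.mono (by simp)
    have hne : m e ∉ E.image m := by
      intro h
      obtain ⟨a, ha, hae⟩ := Finset.mem_image.1 h
      have : a = e := hm (by simp [ha]) (by simp) hae
      exact he (this ▸ ha)
    rw [Finset.image_insert, bexp_insert p hne, bexp_insert p he, ih hm', ih hm']
    simp only [Finset.image_insert]

variable {W : Type*} {G : SimpleGraph V} {H : SimpleGraph W}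

lemma inBall_self (G : SimpleGraph V) (v : V) (n : ℕ) : inBall G v n v :=
  ⟨SimpleGraph.Walk.nil, by simp⟩

lemma inBall_mono {v x : V} {m n : ℕ} (h : m ≤ n) : inBall G v m x → inBall G v n x :=
  fun ⟨q, hq⟩ => ⟨q, hq.trans h⟩

lemma inBall_succ (hlf : ∀ v, (G.neighborSet v).Finite) {v x : V} {n : ℕ} :
    inBall G v (n + 1) x ↔ inBall G v n x ∨ ∃ a, inBall G v n a ∧ G.Adj a x := by
  simp only [← mem_nbh_singleton hlf, mem_nbh_succ]

lemma inBall_zero {v x : V} : inBall G v 0 x ↔ x = v :=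
  ⟨fun ⟨_, hw⟩ => (SimpleGraph.Walk.eq_of_length_eq_zero (Nat.le_zero.1 hw)).symm,
    fun h => h ▸ inBall_self G v 0⟩

lemma ballIso_symm {v : V} {w : W} {R : ℕ} (h : BallIso G H v w R) : BallIso H G w v R := by
  obtain ⟨φ, h0, h1⟩ := h
  refine ⟨φ.symm, ?_, fun a b => ?_⟩
  · have : φ ⟨v, inBall_self G v R⟩ = ⟨w, inBall_self H w R⟩ := Subtype.ext h0
    rw [← this, Equiv.symm_apply_apply]
  · rw [h1, Equiv.apply_symm_apply, Equiv.apply_symm_apply]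

lemma inBall_of_ballIso (hlfG : ∀ v, (G.neighborSet v).Finite)
    (hlfH : ∀ v, (H.neighborSet v).Finite) {v : V} {w : W} {R : ℕ}
    (φ : {x : V // inBall G v R x} ≃ {y : W // inBall H w R y})
    (h0 : (φ ⟨v, inBall_self G v R⟩).1 = w)
    (h1 : ∀ a b : {x : V // inBall G v R x}, G.Adj a.1 b.1 ↔ H.Adj (φ a).1 (φ b).1)
    (k : ℕ) (hk : k ≤ R) (x : {x : V // inBall G v R x}) (hx : inBall H w k (φ x).1) :
    inBall G v k x.1 := by
  induction k generalizing x with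
  | zero =>
    rw [inBall_zero] at hx ⊢
    have : x = ⟨v, inBall_self G v R⟩ := φ.injective (Subtype.ext (hx.trans h0.symm))
    rw [this]
  | succ k ih =>
    rw [inBall_succ hlfH] at hx
    rw [inBall_succ hlfG]
    rcases hx with hx | ⟨a, ha, hax⟩
    · exact Or.inl (ih (by omega) x hx)
    · right
      have e : φ (φ.symm ⟨a, inBall_mono (by omega) ha⟩) = ⟨a, inBall_mono (by omega) ha⟩ :=
        φ.apply_symm_apply _
      exact ⟨_, ih (by omega) (φ.symm ⟨a, inBall_mono (by omega) ha⟩) (by rw [e]; exact ha),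
        (h1 _ x).2 (by rw [e]; exact hax)⟩

/-- The probability of leaving a ball is determined by a slightly larger ball. -/
lemma ex_le_of_ballIso (hlfG : ∀ v, (G.neighborSet v).Finite)
    (hlfH : ∀ v, (H.neighborSet v).Finite) {p : ℝ} (hp0 : 0 ≤ p) (hp1 : p ≤ 1) {v : V} {w : W}
    {n : ℕ} (hb : BallIso G H v w (n + 1)) :
    ex hlfG p (nbh hlfG {v} n) v ≤ ex hlfH p (nbh hlfH {w} n) w := by
  obtain ⟨φ, h0, h1⟩ := hb
  set f : V → W := fun x => if h : inBall G v (n + 1) x then (φ ⟨x, h⟩).1 else w with hf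
  have hfx : ∀ x (h : inBall G v (n + 1) x), f x = (φ ⟨x, h⟩).1 := fun x h => dif_pos h
  have hfv : f v = w := (hfx v (inBall_self G v _)).trans h0
  have hinj : ∀ x y, inBall G v (n + 1) x → inBall G v (n + 1) y → f x = f y → x = y := by
    intro x y hx hy hxy
    rw [hfx x hx, hfx y hy] at hxy
    exact congrArg Subtype.val (φ.injective (Subtype.ext hxy))
  have hends : ∀ e ∈ tE hlfG (nbh hlfG {v} n), ∀ x ∈ e, inBall G v (n + 1) x := by
    intro e he x hxe
    obtain ⟨he, a, ha, hae⟩ := (mem_tE hlfG).1 he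
    have ha' := (mem_nbh_singleton hlfG).1 (Finset.mem_coe.1 ha)
    obtain ⟨b, rfl⟩ := Sym2.mem_iff_exists.1 hae
    rw [inBall_succ hlfG]
    rcases Sym2.mem_iff.1 hxe with rfl | rfl
    · exact Or.inl ha'
    · exact Or.inr ⟨a, ha', he⟩
  have hm : Set.InjOn (Sym2.map f) (tE hlfG (nbh hlfG {v} n)) := by
    intro e he e' he' hee
    have k1 := hends e he
    have k2 := hends e' he'
    clear he he'
    induction e using Sym2.ind with | _ a b =>
    induction e' using Sym2.ind with | _ a' b' =>
    simp only [Sym2.map_mk, Sym2.eq_iff] at hee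
    have ka := k1 a (by simp)
    have kb := k1 b (by simp)
    have ka' := k2 a' (by simp)
    have kb' := k2 b' (by simp)
    rw [Sym2.eq_iff]
    rcases hee with ⟨i, j⟩ | ⟨i, j⟩
    · exact Or.inl ⟨hinj _ _ ka ka' i, hinj _ _ kb kb' j⟩
    · exact Or.inr ⟨hinj _ _ ka kb' i, hinj _ _ kb ka' j⟩
  have hstep : ex hlfG p (nbh hlfG {v} n) v ≤ bexp p (tE hlfG (nbh hlfG {v} n)) (fun S =>
      if cl H (S.image (Sym2.map f)) w ⊆ nbh hlfH {w} n then (0 : ℝ) else 1) := by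
    refine bexp_mono hp0 hp1 fun S hS => ?_
    by_cases hH : cl H (S.image (Sym2.map f)) w ⊆ nbh hlfH {w} n
    swap
    · rw [if_neg hH]; split_ifs <;> norm_num
    have hsub : cl G S v ⊆ {x | inBall G v (n + 1) x
        ∧ f x ∈ cl H (S.image (Sym2.map f)) w} := by
      refine cl_subset_of_closed ⟨inBall_self G v _, ?_⟩ ?_
      · rw [hfv]; exact self_mem_cl _ _
      rintro a ⟨ha, hfa⟩ b - hab hSab
      have hb : inBall G v (n + 1) b := hends _ (hS hSab) b (Sym2.mem_mk_right a b)
      refine ⟨hb, mem_cl_step hfa ?_ ?_⟩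
      · rw [hfx a ha, hfx b hb, ← h1]; exact hab
      · exact Finset.mem_image.2 ⟨_, hSab, by simp⟩
    have hG : cl G S v ⊆ nbh hlfG {v} n := by
      intro x hx
      obtain ⟨hx1, hx2⟩ := hsub hx
      refine (mem_nbh_singleton hlfG).2
        (inBall_of_ballIso hlfG hlfH φ h0 h1 n (Nat.le_succ n) ⟨x, hx1⟩ ?_)
      rw [← hfx]
      exact (mem_nbh_singleton hlfH).1 (hH hx2)
    rw [if_pos hG, if_pos hH]
  refine hstep.trans ?_
  rw [← bexp_image p (Sym2.map f) _ hm
    (fun S => if cl H S w ⊆ nbh hlfH {w} n then (0 : ℝ) else 1)]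
  exact bexp_le_of_le hp0 hp1 _ _ (exit_monotone _ w) (exit_depOn hlfH _ w) fun S => le_rfl

lemma ex_eq_of_ballIso (hlfG : ∀ v, (G.neighborSet v).Finite)
    (hlfH : ∀ v, (H.neighborSet v).Finite) {p : ℝ} (hp0 : 0 ≤ p) (hp1 : p ≤ 1) {v : V} {w : W}
    {n : ℕ} (hb : BallIso G H v w (n + 1)) :
    ex hlfG p (nbh hlfG {v} n) v = ex hlfH p (nbh hlfH {w} n) w :=
  le_antisymm (ex_le_of_ballIso hlfG hlfH hp0 hp1 hb)
    (ex_le_of_ballIso hlfH hlfG hp0 hp1 (ballIso_symm hb))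

lemma inBall_map (φ : G ≃g H) {v x : V} {n : ℕ} (h : inBall G v n x) :
    inBall H (φ v) n (φ x) := by
  obtain ⟨w, hw⟩ := h
  exact ⟨w.map φ.toHom, by rw [SimpleGraph.Walk.length_map]; exact hw⟩

lemma ballIso_of_iso (φ : G ≃g H) (v : V) (n : ℕ) : BallIso G H v (φ v) n := by
  refine ⟨φ.toEquiv.subtypeEquiv fun x => ⟨inBall_map φ, fun h => ?_⟩, rfl, fun a b => ?_⟩
  · have := inBall_map φ.symm h
    simpa using this
  · exact (φ.map_rel_iff (a := a.1) (b := b.1)).symm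

lemma ex_eq_of_isTransitive (ht : IsTransitive G) (hlf : ∀ v, (G.neighborSet v).Finite) {p : ℝ}
    (hp0 : 0 ≤ p) (hp1 : p ≤ 1) (n : ℕ) (u v : V) :
    ex hlf p (nbh hlf {u} n) u = ex hlf p (nbh hlf {v} n) v := by
  obtain ⟨φ, rfl⟩ := ht u v
  exact ex_eq_of_ballIso hlf hlf hp0 hp1 (ballIso_of_iso φ u (n + 1))

/-- Isomorphic balls have roots of the same degree. -/
lemma ncard_neighborSet_eq_of_ballIso {v : V} {w : W} (hb : BallIso G H v w 1) :
    (G.neighborSet v).ncard = (H.neighborSet w).ncard := by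
  obtain ⟨φ, h0, h1⟩ := hb
  have hv : ∀ {x}, G.Adj v x → inBall G v 1 x := fun h => ⟨h.toWalk, by simp⟩
  have hw : ∀ {x}, H.Adj w x → inBall H w 1 x := fun h => ⟨h.toWalk, by simp⟩
  have h2 : ∀ b : {x : V // inBall G v 1 x}, G.Adj v b.1 ↔ H.Adj w (φ b).1 := fun b => by
    rw [h1 ⟨v, inBall_self G v 1⟩ b, h0]
  refine Set.ncard_congr (fun x hx => (φ ⟨x, hv hx⟩).1) ?_ ?_ ?_
  · intro x hx
    exact (h2 ⟨x, hv hx⟩).1 hx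
  · intro x y hx hy hxy
    exact congrArg Subtype.val (φ.injective (Subtype.ext hxy))
  · intro y hy
    have hy' : H.Adj w y := hy
    refine ⟨(φ.symm ⟨y, hw hy'⟩).1, (h2 _).2 (by simpa using hy'), by simp⟩

end LocalComparison

section Subcritical

open scoped Classical

lemma depOn_mono {α β : Type*} {P Q : α → Prop} {f : Finset α → β} (hf : DepOn P f)
    (h : ∀ e, P e → Q e) : DepOn Q f := fun S T hST => hf S T fun e he => hST e (h e he)

lemma depOn_mul {α : Type*} {P : α → Prop} {f g : Finset α → ℝ} (hf : DepOn P f)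
    (hg : DepOn P g) : DepOn P fun S => f S * g S := fun S T hST => by
  simp only [hf S T hST, hg S T hST]

/-- A sum over the possible values of a set contained in `Ω`. -/
lemma sum_ite_set_eq (Ω : Finset V) {K : Set V} (hK : K ⊆ Ω) (F : Finset V → ℝ) :
    ∑ I ∈ Ω.powerset, (if K = I then F I else 0) = F (Ω.filter (· ∈ K)) := by
  have hc : K = (Ω.filter (· ∈ K) : Finset V) := by
    ext x
    simp only [Finset.coe_filter, Set.mem_ofPred_eq]
    exact ⟨fun h => ⟨hK h, h⟩, fun h => h.2⟩
  rw [Finset.sum_eq_single (Ω.filter (· ∈ K)), if_pos hc]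
  · intro I _ hI
    refine if_neg fun h => hI ?_
    rw [h] at hc
    exact Finset.coe_injective (hc.trans (by rw [h]))
  · intro h
    exact absurd (Finset.mem_powerset.2 (Finset.filter_subset _ _)) h

variable {G : SimpleGraph V} (hlf : ∀ v, (G.neighborSet v).Finite)

/-- The configuration restricted to edges inside `A`. -/
noncomputable def ins (A : Set V) (S : Finset (Sym2 V)) : Finset (Sym2 V) :=
  S.filter fun e => ∀ a ∈ e, a ∈ A

lemma mem_ins {A : Set V} {S : Finset (Sym2 V)} {e : Sym2 V} :
    e ∈ ins A S ↔ e ∈ S ∧ ∀ a ∈ e, a ∈ A := by simp [ins]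

lemma forall_mem_mk {A : Set V} {a b : V} : (∀ c ∈ s(a, b), c ∈ A) ↔ a ∈ A ∧ b ∈ A := by
  simp

lemma cl_ins_subset {A : Set V} {o : V} (ho : o ∈ A) (S : Finset (Sym2 V)) :
    cl G (ins A S) o ⊆ A :=
  cl_subset_of_closed ho fun _ _ _ _ _ h => (forall_mem_mk.1 (mem_ins.1 h).2).2

lemma cl_ins_depOn (A : Set V) (o : V) :
    DepOn (fun e => e ∈ G.edgeSet ∧ ∀ a ∈ e, a ∈ A) fun S => cl G (ins A S) o := by
  intro S T h
  refine (cl_congr fun a b hab _ => ?_).symm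
  rw [mem_ins, mem_ins]
  constructor
  · rintro ⟨h1, h2⟩; exact ⟨(h _ ⟨hab, h2⟩).1 h1, h2⟩
  · rintro ⟨h1, h2⟩; exact ⟨(h _ ⟨hab, h2⟩).2 h1, h2⟩

/-- The Duminil-Copin–Tassion functional `φ_p(A)`. -/
noncomputable def phi (p : ℝ) (A : Finset V) (o : V) : ℝ :=
  ∑ x ∈ A, ∑ _y ∈ (hlf x).toFinset \ A,
    p * bexp p (tE hlf A) fun S => if x ∈ cl G (ins A S) o then 1 else 0

lemma phi_nonneg {p : ℝ} (h0 : 0 ≤ p) (h1 : p ≤ 1) (A : Finset V) (o : V) :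
    0 ≤ phi hlf p A o :=
  Finset.sum_nonneg fun _ _ => Finset.sum_nonneg fun _ _ => mul_nonneg h0
    (bexp_nonneg h0 h1 fun S => by split_ifs <;> norm_num)

lemma tE_mono {A Ω : Finset V} (h : A ⊆ Ω) : tE hlf A ⊆ tE hlf Ω := fun e he => by
  rw [mem_tE] at he ⊢
  obtain ⟨h1, a, ha, h2⟩ := he
  exact ⟨h1, a, h ha, h2⟩

lemma phi_eq (p : ℝ) {A : Finset V} {o : V} {E : Finset (Sym2 V)} (hE : tE hlf A ⊆ E) :
    phi hlf p A o = ∑ x ∈ A, ∑ _y ∈ (hlf x).toFinset \ A,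
      p * bexp p E fun S => if x ∈ cl G (ins A S) o then 1 else 0 := by
  refine Finset.sum_congr rfl fun x _ => Finset.sum_congr rfl fun y _ => ?_
  rw [bexp_eq_of_depOn p hE]
  intro S T h
  have := cl_ins_depOn (G := G) (A : Set V) o S T fun e he => h e ((mem_tE hlf).2 ⟨he.1, by
    induction e using Sym2.ind with | _ a b =>
    exact touch_left b (he.2 a (Sym2.mem_mk_left a b))⟩)
  simp only [this]

lemma exit_le_sum {A Ω : Finset V} (hA : A ⊆ Ω) {o : V} (ho : o ∈ A) (S : Finset (Sym2 V)) :
    (if cl G S o ⊆ Ω then (0 : ℝ) else 1)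
      ≤ ∑ x ∈ A, ∑ y ∈ (hlf x).toFinset \ A, ∑ I ∈ A.powerset,
        (if cl G (ins A S) o = I then (if x ∈ I then (if s(x, y) ∈ S then
          (if cl G (off I S) y ⊆ Ω then (0 : ℝ) else 1) else 0) else 0) else 0) := by
  have hCA : cl G (ins A S) o ⊆ A := cl_ins_subset ho S
  simp only [sum_ite_set_eq A hCA]
  set C := A.filter (· ∈ cl G (ins A S) o) with hC
  have hmC : ∀ x, x ∈ C ↔ x ∈ cl G (ins A S) o := fun x => by
    rw [hC, Finset.mem_filter]; exact ⟨fun h => h.2, fun h => ⟨hCA h, h⟩⟩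
  have hnn : ∀ x y : V, (0 : ℝ) ≤ if x ∈ C then (if s(x, y) ∈ S then
      (if cl G (off C S) y ⊆ Ω then (0 : ℝ) else 1) else 0) else 0 := fun x y => by
    split_ifs <;> norm_num
  by_cases hS : cl G S o ⊆ Ω
  · rw [if_pos hS]
    exact Finset.sum_nonneg fun x _ => Finset.sum_nonneg fun y _ => hnn x y
  rw [if_neg hS]
  by_contra hlt
  apply hS
  have hz : ∀ x ∈ C, ∀ y, G.Adj x y → y ∉ A → s(x, y) ∈ S → cl G (off C S) y ⊆ Ω := by
    intro x hx y hxy hyA hxyS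
    by_contra hy
    apply hlt
    have hxA := hCA ((hmC x).1 hx)
    refine le_trans ?_ (Finset.single_le_sum
      (f := fun x => ∑ y ∈ (hlf x).toFinset \ A, if x ∈ C then (if s(x, y) ∈ S then
      (if cl G (off C S) y ⊆ Ω then (0 : ℝ) else 1) else 0) else 0)
      (fun x _ => Finset.sum_nonneg fun y _ => hnn x y) hxA)
    refine le_trans ?_ (Finset.single_le_sum
      (f := fun y => if x ∈ C then (if s(x, y) ∈ S then
      (if cl G (off C S) y ⊆ Ω then (0 : ℝ) else 1) else 0) else 0)
      (fun y _ => hnn x y) (a := y) (by simp [hyA, hxy]))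
    simp [hx, hxyS, hy]
  have hsub : cl G S o ⊆ {z | z ∈ Ω ∧ (z ∈ C ∨ ∃ x ∈ C, ∃ y, G.Adj x y ∧ y ∉ A ∧
      s(x, y) ∈ S ∧ z ∈ cl G (off C S) y)} := by
    refine cl_subset_of_closed ⟨hA ho, Or.inl ((hmC o).2 (self_mem_cl _ _))⟩ ?_
    have hCcase : ∀ a ∈ C, ∀ b, G.Adj a b → s(a, b) ∈ S → b ∈ Ω ∧ (b ∈ C ∨ ∃ x ∈ C, ∃ y,
        G.Adj x y ∧ y ∉ A ∧ s(x, y) ∈ S ∧ b ∈ cl G (off C S) y) := by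
      intro a ha b hab hS'
      by_cases hb : b ∈ A
      · refine ⟨hA hb, Or.inl ((hmC b).2 (mem_cl_step ((hmC a).1 ha) hab ?_))⟩
        exact mem_ins.2 ⟨hS', forall_mem_mk.2 ⟨hCA ((hmC a).1 ha), hb⟩⟩
      · exact ⟨hz a ha b hab hb hS' (self_mem_cl _ _),
          Or.inr ⟨a, ha, b, hab, hb, hS', self_mem_cl _ _⟩⟩
    rintro a ⟨haΩ, ha⟩ b - hab hS'
    by_cases haC : a ∈ C
    · exact hCcase a haC b hab hS'
    rcases ha with ha | ⟨x, hx, y, hxy, hyA, hxyS, hay⟩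
    · exact absurd ha haC
    by_cases hbC : b ∈ C
    · exact ⟨hA (hCA ((hmC b).1 hbC)), Or.inl hbC⟩
    have hb : b ∈ cl G (off C S) y := mem_cl_step hay hab (mem_off.2 ⟨hS', fun ht => by
      rcases touch_mk.1 ht with h | h
      · exact haC h
      · exact hbC h⟩)
    exact ⟨hz x hx y hxy hyA hxyS hb, Or.inr ⟨x, hx, y, hxy, hyA, hxyS, hb⟩⟩
  exact fun z hz' => (hsub hz').1

lemma ex_le_phi_mul {p : ℝ} (h0 : 0 ≤ p) (h1 : p ≤ 1) {A Ω : Finset V} (hA : A ⊆ Ω) {o : V}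
    (ho : o ∈ A) {t : ℝ} (ht : ∀ x ∈ A, ∀ y, G.Adj x y → ex hlf p Ω y ≤ t) :
    ex hlf p Ω o ≤ phi hlf p A o * t := by
  set E := tE hlf Ω with hE
  have hterm : ∀ x ∈ A, ∀ y ∈ (hlf x).toFinset \ A, ∀ I ∈ A.powerset,
      bexp p E (fun S => (if cl G (ins A S) o = I then (if x ∈ I then (if s(x, y) ∈ S then
          (if cl G (off I S) y ⊆ Ω then (0 : ℝ) else 1) else 0) else 0) else 0))
      ≤ bexp p E (fun S => if cl G (ins A S) o = I then (if x ∈ I then (1 : ℝ) else 0) else 0)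
          * p * t := by
    intro x hx y hy I hI
    have hxy : G.Adj x y := by simpa using (Finset.mem_sdiff.1 hy).1
    have hyA : y ∉ A := (Finset.mem_sdiff.1 hy).2
    by_cases hxI : x ∈ I
    swap
    · simp [hxI, bexp_const]
    simp only [hxI, if_true]
    set a : Finset (Sym2 V) → ℝ := fun S => if cl G (ins A S) o = I then 1 else 0 with ha
    set b : Finset (Sym2 V) → ℝ := fun S => if s(x, y) ∈ S then 1 else 0 with hb
    set c : Finset (Sym2 V) → ℝ := fun S => if cl G (off I S) y ⊆ Ω then 0 else 1 with hc
    have e1 : (fun S => if cl G (ins A S) o = I then (if s(x, y) ∈ S then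
        (if cl G (off I S) y ⊆ Ω then (0 : ℝ) else 1) else 0) else 0)
        = fun S => (a S * b S) * c S := by
      funext S
      simp only [ha, hb, hc]
      split_ifs <;> simp
    have hda : DepOn (fun e => touch (I : Set V) e ∧ ∀ v ∈ e, v ∈ (A : Set V)) a := by
      intro S T h
      have := cl_eq_iff_of_agree (G := G) (I := (I : Set V)) (S := ins A S) (T := ins A T)
        (fun e he => by
          rw [mem_ins, mem_ins]
          constructor
          · rintro ⟨h1, h2⟩; exact ⟨(h e ⟨he, h2⟩).1 h1, h2⟩
          · rintro ⟨h1, h2⟩; exact ⟨(h e ⟨he, h2⟩).2 h1, h2⟩) o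
      simp only [ha, this]
    have hdb : DepOn (fun e => e = s(x, y)) b := by
      intro S T h
      simp only [hb, h _ rfl]
    have hdc : DepOn (fun e => ¬ touch (I : Set V) e) c := by
      intro S T h
      have : off (I : Set V) S = off I T := by
        ext e
        rw [mem_off, mem_off]
        exact and_congr_left fun he => h e he
      simp only [hc, this]
    have hdab : DepOn (touch (I : Set V)) fun S => a S * b S :=
      depOn_mul (depOn_mono hda fun e he => he.1)
        (depOn_mono hdb fun e he => he ▸ touch_left y hxI)
    have hcE : bexp p E c ≤ t := by
      refine le_trans (bexp_mono h0 h1 fun S _ => ?_) (ht x hx y hxy)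
      have := exit_monotone (G := G) (Ω : Set V) y (off_subset (I : Set V) S)
      exact this
    have hmem : s(x, y) ∈ E := (mem_tE hlf).2 ⟨hxy, touch_left y (hA hx)⟩
    have hneg : DepOn (fun e => ¬ ∀ v ∈ e, v ∈ (A : Set V)) b :=
      depOn_mono hdb fun e he => by rw [he, forall_mem_mk]; exact fun h => hyA h.2
    rw [e1, bexp_mul_of_depOn p E _ hdab hdc,
      bexp_mul_of_depOn p E (fun e => ∀ v ∈ e, v ∈ (A : Set V))
        (depOn_mono hda fun e he => he.2) hneg, hb, bexp_mem p hmem]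
    exact mul_le_mul_of_nonneg_left hcE (mul_nonneg
      (bexp_nonneg h0 h1 fun S => by simp only [ha]; split_ifs <;> norm_num) h0)
  calc ex hlf p Ω o
      ≤ ∑ x ∈ A, ∑ y ∈ (hlf x).toFinset \ A, ∑ I ∈ A.powerset,
        bexp p E (fun S => (if cl G (ins A S) o = I then (if x ∈ I then (if s(x, y) ∈ S then
          (if cl G (off I S) y ⊆ Ω then (0 : ℝ) else 1) else 0) else 0) else 0)) := by
        simp only [← bexp_sum]
        exact bexp_mono h0 h1 fun S _ => exit_le_sum hlf hA ho S
    _ ≤ ∑ x ∈ A, ∑ y ∈ (hlf x).toFinset \ A, ∑ I ∈ A.powerset,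
        bexp p E (fun S => if cl G (ins A S) o = I then (if x ∈ I then (1 : ℝ) else 0) else 0)
          * p * t :=
        Finset.sum_le_sum fun x hx => Finset.sum_le_sum fun y hy => Finset.sum_le_sum fun I hI =>
          hterm x hx y hy I hI
    _ = phi hlf p A o * t := by
        rw [phi_eq hlf p (tE_mono hlf hA), Finset.sum_mul]
        refine Finset.sum_congr rfl fun x hx => ?_
        rw [Finset.sum_mul]
        refine Finset.sum_congr rfl fun y _ => ?_
        rw [← Finset.sum_mul, ← Finset.sum_mul, ← bexp_sum, mul_comm p]
        congr 3
        funext S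
        rw [sum_ite_set_eq A (cl_ins_subset (Finset.mem_coe.2 ho) S)
          (fun I => if x ∈ I then (1 : ℝ) else 0)]
        simp [hx]

lemma nbh_add (I : Finset V) (k l : ℕ) : nbh hlf (nbh hlf I k) l = nbh hlf I (k + l) := by
  induction l with
  | zero => rfl
  | succ l ih => rw [← add_assoc, nbh, nbh, ih]

lemma nbh_subset {I J : Finset V} (h : I ⊆ J) (k : ℕ) : nbh hlf I k ⊆ nbh hlf J k := by
  induction k with
  | zero => exact h
  | succ k ih =>
    intro y hy
    rw [mem_nbh_succ] at hy ⊢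
    rcases hy with hy | ⟨a, ha, hay⟩
    · exact Or.inl (ih hy)
    · exact Or.inr ⟨a, ih ha, hay⟩

/-- If `φ_p(A) < 1` for some finite `A`, then there is no percolation at `p`. -/
lemma theta_nonpos_of_phi_lt_one (ht : IsTransitive G) {p : ℝ} (h0 : 0 ≤ p) (h1 : p ≤ 1)
    {A : Finset V} {o : V} (ho : o ∈ A) {L : ℕ} (hL : A ⊆ nbh hlf {o} L)
    (hphi : phi hlf p A o < 1) : theta G p o ≤ 0 := by
  have hrec : ∀ n, ex hlf p (nbh hlf {o} (L + 1 + n)) o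
      ≤ phi hlf p A o * ex hlf p (nbh hlf {o} n) o := by
    intro n
    refine ex_le_phi_mul hlf h0 h1 (hL.trans (nbh_mono hlf _ (by omega))) ho
      fun x hx y hxy => ?_
    rw [ex_eq_of_isTransitive ht hlf h0 h1 n o y]
    refine ex_anti hlf h0 h1 ?_ y
    rw [← nbh_add]
    refine nbh_subset hlf (Finset.singleton_subset_iff.2 ?_) n
    exact (mem_nbh_succ hlf).2 (Or.inr ⟨x, hL hx, hxy⟩)
  have hpow : ∀ k : ℕ, ex hlf p (nbh hlf {o} ((L + 1) * k)) o ≤ phi hlf p A o ^ k := by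
    intro k
    induction k with
    | zero => simpa using ex_le_one hlf h0 h1 _ o
    | succ k ih =>
      have := hrec ((L + 1) * k)
      rw [show (L + 1) * (k + 1) = L + 1 + (L + 1) * k by ring, pow_succ']
      exact this.trans (mul_le_mul_of_nonneg_left ih (phi_nonneg hlf h0 h1 A o))
  exact ge_of_tendsto' (tendsto_pow_atTop_nhds_zero_of_lt_one (phi_nonneg hlf h0 h1 A o) hphi)
    fun k => (theta_le hlf h0 h1 o _).trans (hpow k)

end Subcritical

section Sharpness

open scoped Classical

/-- The vertices of `Ω` whose cluster stays inside `Ω`. -/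
noncomputable def safe (G : SimpleGraph V) (Ω : Finset V) (S : Finset (Sym2 V)) : Finset V :=
  Ω.filter fun x => cl G S x ⊆ Ω

variable {G : SimpleGraph V} (hlf : ∀ v, (G.neighborSet v).Finite)

lemma mem_safe {Ω : Finset V} {S : Finset (Sym2 V)} {x : V} :
    x ∈ safe G Ω S ↔ cl G S x ⊆ Ω := by
  simp only [safe, Finset.mem_filter, and_iff_right_iff_imp]
  exact fun h => h (self_mem_cl S x)

lemma cl_subset_safe {Ω : Finset V} {S : Finset (Sym2 V)} {x : V} (hx : x ∈ safe G Ω S) :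
    cl G S x ⊆ safe G Ω S := by
  intro y hy
  have : cl G S y ⊆ Ω := by rw [cl_eq_of_mem hy]; exact mem_safe.1 hx
  exact mem_safe.2 this

lemma safe_eq_of_agree {Ω I : Finset V} {S T : Finset (Sym2 V)} (hS : safe G Ω S = I)
    (h : ∀ e, (¬ ∀ a ∈ e, a ∈ (I : Set V)) → (e ∈ S ↔ e ∈ T)) : safe G Ω T = I := by
  ext x
  constructor
  · intro hx
    by_contra hxI
    have hdis : ∀ a ∈ cl G S x, a ∉ I := by
      intro a ha haI
      rw [← hS] at haI hxI
      exact hxI (cl_subset_safe haI (mem_cl_symm ha))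
    have : cl G T x = cl G S x := cl_congr fun a b _ ha => h _ fun hall =>
      hdis a ha (hall a (Sym2.mem_mk_left a b))
    rw [← hS, mem_safe, ← this] at hxI
    exact hxI (mem_safe.1 hx)
  · intro hx
    rw [mem_safe]
    have hIΩ : (I : Set V) ⊆ Ω := by rw [← hS]; exact fun y hy => (Finset.mem_filter.1 hy).1
    refine Set.Subset.trans (cl_subset_of_closed (K := I) hx ?_) hIΩ
    intro a ha b _ hab hT
    by_contra hb
    have hSab : s(a, b) ∈ S := (h _ fun hall => hb (hall b (Sym2.mem_mk_right a b))).2 hT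
    have ha' : a ∈ safe G Ω S := hS ▸ ha
    have := cl_subset_safe ha' (mem_cl_step (self_mem_cl S a) hab hSab)
    rw [hS] at this
    exact hb this

lemma sum_boundary_le_pivotal {Ω : Finset V} (o : V) (S : Finset (Sym2 V)) :
    ∑ I ∈ Ω.powerset, (if safe G Ω S = I then (if o ∈ I then
        ∑ x ∈ I, ∑ _y ∈ (hlf x).toFinset \ I, (if x ∈ cl G (ins I S) o then (1 : ℝ) else 0)
        else 0) else 0)
      ≤ ∑ e ∈ tE hlf Ω, ((if cl G (insert e S) o ⊆ Ω then (0 : ℝ) else 1)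
          - (if cl G (S.erase e) o ⊆ Ω then 0 else 1)) := by
  set f : Finset (Sym2 V) → ℝ := fun S => if cl G S o ⊆ Ω then 0 else 1 with hf
  have hfm : Monotone f := exit_monotone (G := G) (Ω : Set V) o
  change _ ≤ ∑ e ∈ tE hlf Ω, (f (insert e S) - f (S.erase e))
  have hnn : ∀ e ∈ tE hlf Ω, 0 ≤ f (insert e S) - f (S.erase e) := fun e _ =>
    sub_nonneg.2 (hfm ((Finset.erase_subset e S).trans (Finset.subset_insert e S)))
  rw [Finset.sum_ite_eq]
  set I := safe G Ω S with hI
  have hIΩ : I ⊆ Ω := Finset.filter_subset _ _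
  rw [if_pos (Finset.mem_powerset.2 hIΩ)]
  by_cases ho : o ∈ I
  swap
  · rw [if_neg ho]; exact Finset.sum_nonneg hnn
  rw [if_pos ho, Finset.sum_sigma']
  set P := I.sigma fun x => (hlf x).toFinset \ I with hP
  have hmP : ∀ q ∈ P, q.1 ∈ I ∧ G.Adj q.1 q.2 ∧ q.2 ∉ I := by
    intro q hq
    simpa [hP] using hq
  let m : (Σ _ : V, V) → Sym2 V := fun q => s(q.1, q.2)
  have hinj : Set.InjOn m P := by
    rintro ⟨x, y⟩ hq ⟨x', y'⟩ hq' h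
    have h1 := hmP _ (Finset.mem_coe.1 hq)
    have h2 := hmP _ (Finset.mem_coe.1 hq')
    simp only [m, Sym2.eq_iff] at h
    rcases h with ⟨rfl, rfl⟩ | ⟨rfl, rfl⟩
    · rfl
    · exact absurd h1.1 h2.2.2
  have hoS : f S = 0 := if_pos (mem_safe.1 ho)
  calc _ ≤ ∑ q ∈ P, (f (insert (m q) S) - f (S.erase (m q))) := by
        refine Finset.sum_le_sum fun q hq => ?_
        obtain ⟨h1, h2, h3⟩ := hmP q hq
        have he : f (S.erase (m q)) = 0 := le_antisymm
          (hoS ▸ hfm (Finset.erase_subset _ _)) (by simp only [hf]; split_ifs <;> norm_num)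
        rw [he, sub_zero]
        by_cases hx : q.1 ∈ cl G (ins I S) o
        swap
        · rw [if_neg hx]; simp only [hf]; split_ifs <;> norm_num
        rw [if_pos hx]
        have hxS : q.1 ∈ cl G S o := cl_mono (Finset.filter_subset _ _) o hx
        have hsub := cl_union_subset_insert hxS h2
        have : ¬ cl G (insert (m q) S) o ⊆ Ω := fun hc =>
          h3 (mem_safe.2 ((Set.subset_union_right.trans hsub).trans hc))
        simp only [hf]
        rw [if_neg this]
    _ = ∑ e ∈ P.image m, (f (insert e S) - f (S.erase e)) := by
        rw [Finset.sum_image hinj]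
    _ ≤ _ := by
        refine Finset.sum_le_sum_of_subset_of_nonneg ?_ fun e he _ => hnn e he
        intro e he
        obtain ⟨q, hq, rfl⟩ := Finset.mem_image.1 he
        obtain ⟨h1, h2, h3⟩ := hmP q hq
        exact (mem_tE hlf).2 ⟨h2, touch_left _ (hIΩ h1)⟩

lemma one_sub_ex_le {p : ℝ} (h0 : 0 ≤ p) (h1 : p ≤ 1) {Ω : Finset V} {o : V}
    (hphi : ∀ A ⊆ Ω, o ∈ A → 1 ≤ phi hlf p A o) :
    1 - ex hlf p Ω o ≤ bexp p (tE hlf Ω) fun S => ∑ e ∈ tE hlf Ω,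
      ((if cl G (insert e S) o ⊆ Ω then (0 : ℝ) else 1)
          - (if cl G (S.erase e) o ⊆ Ω then 0 else 1)) := by
  set E := tE hlf Ω with hE
  refine le_trans ?_ (bexp_mono h0 h1 fun S _ => sum_boundary_le_pivotal hlf o S)
  have hterm : ∀ I ∈ Ω.powerset,
      bexp p E (fun S => if safe G Ω S = I then (if o ∈ I then (1 : ℝ) else 0) else 0)
      ≤ bexp p E (fun S => if safe G Ω S = I then (if o ∈ I then
        ∑ x ∈ I, ∑ _y ∈ (hlf x).toFinset \ I, (if x ∈ cl G (ins I S) o then (1 : ℝ) else 0)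
        else 0) else 0) := by
    intro I hI
    rw [Finset.mem_powerset] at hI
    by_cases ho : o ∈ I
    swap
    · simp [ho]
    simp only [ho, if_true]
    set a : Finset (Sym2 V) → ℝ := fun S => if safe G Ω S = I then 1 else 0 with ha
    set b : Finset (Sym2 V) → ℝ := fun S =>
      ∑ x ∈ I, ∑ _y ∈ (hlf x).toFinset \ I, (if x ∈ cl G (ins I S) o then (1 : ℝ) else 0) with hb
    have e1 : (fun S => if safe G Ω S = I then
        ∑ x ∈ I, ∑ _y ∈ (hlf x).toFinset \ I, (if x ∈ cl G (ins I S) o then (1 : ℝ) else 0)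
        else 0) = fun S => b S * a S := by
      funext S
      simp only [ha, hb]
      split_ifs <;> simp
    have hda : DepOn (fun e => ¬ ∀ v ∈ e, v ∈ (I : Set V)) a := by
      intro S T h
      have : safe G Ω S = I ↔ safe G Ω T = I :=
        ⟨fun hS => safe_eq_of_agree hS h, fun hT => safe_eq_of_agree hT fun e he => (h e he).symm⟩
      simp only [ha, this]
    have hdb : DepOn (fun e => ∀ v ∈ e, v ∈ (I : Set V)) b := by
      intro S T h
      have := cl_ins_depOn (G := G) (I : Set V) o S T fun e he => h e he.2
      simp only [hb, this]
    rw [e1, bexp_mul_of_depOn p E _ hdb hda]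
    have hb1 : 1 ≤ bexp p E b := by
      refine (hphi I hI ho).trans ?_
      rw [phi_eq hlf p (tE_mono hlf hI)]
      simp only [hb, bexp_sum]
      refine Finset.sum_le_sum fun x _ => Finset.sum_le_sum fun y _ => ?_
      exact mul_le_of_le_one_left
        (bexp_nonneg h0 h1 fun S => by split_ifs <;> norm_num) h1
    exact le_mul_of_one_le_left
      (bexp_nonneg h0 h1 fun S => by simp only [ha]; split_ifs <;> norm_num) hb1
  rw [bexp_sum]
  refine le_trans (le_of_eq ?_) (Finset.sum_le_sum hterm)
  rw [← bexp_sum, show 1 - ex hlf p Ω o = bexp p E (fun _ => 1)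
    - bexp p E (fun S => if cl G S o ⊆ Ω then 0 else 1) by rw [bexp_const]; rfl, ← bexp_sub]
  refine bexp_congr fun S _ => ?_
  have hmem : safe G Ω S ∈ Ω.powerset := Finset.mem_powerset.2 (Finset.filter_subset _ _)
  rw [Finset.sum_ite_eq, if_pos hmem]
  by_cases h : cl G S o ⊆ Ω
  · simp [h, mem_safe.2 h]
  · have : o ∉ safe G Ω S := fun h' => h (mem_safe.1 h')
    simp [h, this]

lemma hasDerivAt_ex (Ω : Finset V) (o : V) (p : ℝ) :
    HasDerivAt (fun q => ex hlf q Ω o)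
      (bexp p (tE hlf Ω) fun S => ∑ e ∈ tE hlf Ω,
      ((if cl G (insert e S) o ⊆ Ω then (0 : ℝ) else 1)
          - (if cl G (S.erase e) o ⊆ Ω then 0 else 1))) p := by
  have := hasDerivAt_bexp (tE hlf Ω) (fun _ S => if cl G S o ⊆ Ω then (0 : ℝ) else 1)
    (fun _ => 0) p fun S => hasDerivAt_const p _
  rw [bexp_const, add_zero] at this
  exact this

lemma exists_subset_nbh (hconn : G.Connected) (o : V) (A : Finset V) :
    ∃ L, A ⊆ nbh hlf {o} L := by
  induction A using Finset.induction_on with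
  | empty => exact ⟨0, by simp⟩
  | insert a A _ ih =>
    obtain ⟨L, hL⟩ := ih
    obtain ⟨w⟩ := hconn.preconnected o a
    refine ⟨max L w.length, Finset.insert_subset ?_ (hL.trans (nbh_mono hlf _ (le_max_left _ _)))⟩
    exact (mem_nbh_singleton hlf).2 ⟨w, le_max_right _ _⟩

/-- Percolation at `p` forces quantitative percolation at every larger parameter. -/
lemma le_ex_of_theta_pos (hconn : G.Connected) (ht : IsTransitive G) {p p' : ℝ} (h0 : 0 ≤ p)
    (hpp : p < p') (h1 : p' ≤ 1) {o : V} (hθ : 0 < theta G p o) (n : ℕ) :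
    (p' - p) / 2 ≤ ex hlf p' (nbh hlf {o} n) o := by
  set Ω := nbh hlf {o} n
  obtain ⟨q, ⟨hq0, hq1⟩, hq⟩ := exists_hasDerivAt_eq_slope (fun q => ex hlf q Ω o) _ hpp
    (fun q _ => (hasDerivAt_ex hlf Ω o q).continuousAt.continuousWithinAt)
    (fun q _ => hasDerivAt_ex hlf Ω o q)
  have hq0' : 0 ≤ q := h0.trans hq0.le
  have hq1' : q ≤ 1 := hq1.le.trans h1
  have key := one_sub_ex_le hlf hq0' hq1' (Ω := Ω) (o := o) fun A _ hoA => by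
    by_contra hlt
    obtain ⟨L, hL⟩ := exists_subset_nbh hlf hconn o A
    have := theta_nonpos_of_phi_lt_one hlf ht hq0' hq1' hoA hL (not_le.1 hlt)
    exact absurd (hθ.trans_le (theta_mono hlf h0 hq0.le hq1' o)) (not_lt.2 this)
  rw [hq, le_div_iff₀ (sub_pos.2 hpp)] at key
  have a1 := ex_mono hlf hq0' hq1.le h1 Ω o
  have a2 := ex_nonneg hlf h0 (hpp.le.trans h1) Ω o
  have a3 := ex_nonneg hlf (h0.trans hpp.le) h1 Ω o
  nlinarith [mul_le_mul_of_nonneg_right a1 (sub_pos.2 hpp).le]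

end Sharpness

section Weights

open scoped Classical

/-- The exponential cluster weight, killed outside of `Ω`. -/
noncomputable def wt (h : ℝ) (Ω : Finset V) (K : Set V) : ℝ :=
  if K ⊆ Ω then Real.exp (-(h * K.ncard)) else 0

/-- A set which leaves `Ω` or has size at least `θ / (2h)`. -/
def big (h θ : ℝ) (Ω : Finset V) (K : Set V) : Prop := ¬ K ⊆ Ω ∨ θ / 2 ≤ h * K.ncard

lemma wt_nonneg (h : ℝ) (Ω : Finset V) (K : Set V) : 0 ≤ wt h Ω K := by
  unfold wt; split_ifs
  · exact (Real.exp_pos _).le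
  · exact le_rfl

lemma wt_le_one {h : ℝ} (hh : 0 ≤ h) (Ω : Finset V) (K : Set V) : wt h Ω K ≤ 1 := by
  unfold wt; split_ifs
  · rw [Real.exp_le_one_iff, neg_nonpos]; positivity
  · exact zero_le_one

lemma wt_anti {h : ℝ} (hh : 0 ≤ h) (Ω : Finset V) {K K' : Set V} (hK : K ⊆ K') :
    wt h Ω K' ≤ wt h Ω K := by
  by_cases h' : K' ⊆ Ω
  · have h'' : K ⊆ Ω := hK.trans h'
    rw [wt, wt, if_pos h', if_pos h'', Real.exp_le_exp, neg_le_neg_iff]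
    have : K.ncard ≤ K'.ncard := Set.ncard_le_ncard hK (Ω.finite_toSet.subset h')
    gcongr
  · rw [wt, if_neg h']; exact wt_nonneg _ _ _

lemma wt_union (h : ℝ) (Ω : Finset V) {K K' : Set V} (hd : Disjoint K K') :
    wt h Ω (K ∪ K') = wt h Ω K * wt h Ω K' := by
  unfold wt
  by_cases h1 : K ⊆ Ω <;> by_cases h2 : K' ⊆ Ω
  · rw [if_pos (Set.union_subset h1 h2), if_pos h1, if_pos h2, ← Real.exp_add,
      Set.ncard_union_eq hd (Ω.finite_toSet.subset h1) (Ω.finite_toSet.subset h2)]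
    push_cast
    ring_nf
  · rw [if_neg (fun hc => h2 (Set.subset_union_right.trans hc)), if_neg h2, mul_zero]
  · rw [if_neg (fun hc => h1 (Set.subset_union_left.trans hc)), if_neg h1, zero_mul]
  · rw [if_neg (fun hc => h1 (Set.subset_union_left.trans hc)), if_neg h1, zero_mul]

lemma half_le_one_sub_exp_neg {t : ℝ} (h0 : 0 ≤ t) (h1 : t ≤ 1) : t / 2 ≤ 1 - Real.exp (-t) := by
  have h2 : 1 + t ≤ Real.exp t := by linarith [Real.add_one_le_exp t]
  have h3 : Real.exp (-t) ≤ (1 + t)⁻¹ := by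
    rw [Real.exp_neg]; exact inv_anti₀ (by linarith) h2
  have h4 : (1 + t)⁻¹ ≤ 1 - t / 2 := by
    rw [inv_le_iff_one_le_mul₀ (by linarith)]; nlinarith
  linarith

lemma one_sub_wt_le_big {h θ : ℝ} (hθ : 0 ≤ θ) (Ω : Finset V) (K : Set V) :
    1 - wt h Ω K ≤ (if big h θ Ω K then 1 else 0) + θ / 2 := by
  by_cases hb : big h θ Ω K
  · rw [if_pos hb]; linarith [wt_nonneg h Ω K]
  · rw [if_neg hb]
    simp only [big, not_or, not_not, not_le] at hb
    rw [wt, if_pos hb.1]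
    linarith [Real.add_one_le_exp (-(h * K.ncard)), hb.2]

lemma big_le {h s θ B : ℝ} (hB : 1 ≤ B) (hθ : 0 < θ) (hθ1 : θ ≤ 1) (hs : h ≤ B * s)
    (Ω : Finset V) (K : Set V) (hb : big h θ Ω K) :
    θ ≤ 4 * B * (1 - wt s Ω K) := by
  by_cases hK : K ⊆ Ω
  · have h1 : θ / 2 ≤ h * K.ncard := hb.resolve_left (not_not.2 hK)
    have h2 : θ / 2 ≤ B * (s * K.ncard) := by
      have := mul_le_mul_of_nonneg_right hs (Nat.cast_nonneg (α := ℝ) K.ncard)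
      linarith
    rw [wt, if_pos hK]
    set t := θ / (2 * B) with ht
    have hB0 : 0 < B := by linarith
    have ht0 : 0 ≤ t := by positivity
    have ht1 : t ≤ 1 := by rw [ht, div_le_one (by positivity)]; linarith
    have hts : t ≤ s * K.ncard := by
      rw [ht, div_le_iff₀ (by positivity)]; linarith
    have h3 := half_le_one_sub_exp_neg ht0 ht1
    have h4 : Real.exp (-(s * K.ncard)) ≤ Real.exp (-t) := Real.exp_le_exp.2 (by linarith)
    calc θ = 4 * B * (t / 2) := by rw [ht]; field_simp; ring
      _ ≤ _ := by gcongr; linarith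
  · rw [wt, if_neg hK]; linarith

lemma small_le {h s θ B : ℝ} (hB : 1 ≤ B) (hθ1 : θ ≤ 1) (hs : h ≤ B * s)
    (hs0 : 0 ≤ s) (hsh : s ≤ h) (Ω : Finset V) (K : Set V) (hb : ¬ big h θ Ω K) :
    h * K.ncard ≤ 2 * B * (1 - wt s Ω K) := by
  simp only [big, not_or, not_not, not_le] at hb
  rw [wt, if_pos hb.1]
  have hn : (0 : ℝ) ≤ K.ncard := Nat.cast_nonneg _
  have h1 : s * K.ncard ≤ h * K.ncard := by gcongr
  have h2 := half_le_one_sub_exp_neg (t := s * K.ncard) (by positivity) (by linarith)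
  have h3 : h * K.ncard ≤ B * (s * K.ncard) := by
    have := mul_le_mul_of_nonneg_right hs hn
    linarith
  have : B * (s * K.ncard / 2) ≤ B * (1 - Real.exp (-(s * K.ncard))) := by gcongr
  linarith

variable {G : SimpleGraph V} (hlf : ∀ v, (G.neighborSet v).Finite)

lemma wt_cl_anti {h : ℝ} (hh : 0 ≤ h) (Ω : Finset V) (x : V) :
    Antitone fun S : Finset (Sym2 V) => wt h Ω (cl G S x) := fun _ _ hST =>
  wt_anti hh Ω (cl_mono hST x)

lemma wt_cl_depOn (h : ℝ) (Ω : Finset V) (x : V) :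
    DepOn (· ∈ tE hlf Ω) fun S : Finset (Sym2 V) => wt h Ω (cl G S x) := by
  intro S T hST
  have hag : ∀ e ∈ G.edgeSet, touch (Ω : Set V) e → (e ∈ S ↔ e ∈ T) :=
    fun e he ht => hST e ((mem_tE hlf).2 ⟨he, ht⟩)
  have hiff := cl_subset_iff_of_agree (G := G) (I := (Ω : Set V)) (S := S) (T := T) hag x
  by_cases hS : cl G S x ⊆ Ω
  · have : cl G T x = cl G S x := cl_congr fun a b hab ha => hag _ hab (touch_left b (hS ha))
    simp only [this]
  · have hT : ¬ cl G T x ⊆ Ω := fun hT => hS (hiff.2 hT)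
    simp only [wt, if_neg hS, if_neg hT]

lemma big_cl_mono {h θ : ℝ} (hh : 0 ≤ h) (Ω : Finset V) (x : V) :
    Monotone fun S : Finset (Sym2 V) => if big h θ Ω (cl G S x) then (1 : ℝ) else 0 := by
  intro S T hST
  have hsub := cl_mono (G := G) hST x
  have : big h θ Ω (cl G S x) → big h θ Ω (cl G T x) := by
    intro hb
    by_cases hT : cl G T x ⊆ Ω
    · right
      have h1 := hb.resolve_left (not_not.2 (hsub.trans hT))
      have h2 : (cl G S x).ncard ≤ (cl G T x).ncard :=
        Set.ncard_le_ncard hsub (Ω.finite_toSet.subset hT)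
      exact h1.trans (by gcongr)
    · exact Or.inl hT
  by_cases hS : big h θ Ω (cl G S x)
  · simp [hS, this hS]
  · simp only [hS, if_false]
    split_ifs <;> norm_num

lemma cl_off_disjoint {I : Set V} {S : Finset (Sym2 V)} {y : V} (hy : y ∉ I) :
    ∀ a ∈ cl G (off I S) y, a ∉ I := by
  have : cl G (off I S) y ⊆ {a | a ∉ I} := cl_subset_of_closed (K := {a | a ∉ I}) hy
    fun a _ b _ _ h hb => (mem_off.1 h).2 (touch_mk.2 (Or.inr hb))
  exact fun a ha => this ha

/-- Either the off-`I` cluster of `y` is already big, or it reaches the boundary of `I`. -/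
lemma big_le_add {h θ : ℝ} {Ω I : Finset V} {y : V} (hy : y ∉ I)
    (S : Finset (Sym2 V)) :
    (if big h θ Ω (cl G S y) then (1 : ℝ) else 0)
      ≤ (if big h θ Ω (cl G (off I S) y) then 1 else 0)
        + ∑ z ∈ bd hlf I, (if y ∈ cl G (off I S) z ∧ ¬ big h θ Ω (cl G (off I S) z)
          then (1 : ℝ) else 0) := by
  have hnn : ∀ z ∈ bd hlf I, (0 : ℝ) ≤ if y ∈ cl G (off I S) z
      ∧ ¬ big h θ Ω (cl G (off I S) z) then (1 : ℝ) else 0 := fun z _ => by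
    split_ifs <;> norm_num
  have hsum := Finset.sum_nonneg hnn
  by_cases hb' : big h θ Ω (cl G (off I S) y)
  · rw [if_pos hb']
    split_ifs <;> linarith
  rw [if_neg hb', zero_add]
  by_cases hb : big h θ Ω (cl G S y)
  swap
  · rw [if_neg hb]; exact hsum
  rw [if_pos hb]
  obtain ⟨z, hz, hzy⟩ : ∃ z ∈ bd hlf I, z ∈ cl G (off I S) y := by
    by_contra hcon
    push Not at hcon
    have : cl G S y = cl G (off I S) y := cl_congr fun a b hab ha => by
      rw [mem_off, and_iff_left_iff_imp]
      intro _ ht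
      have haI := cl_off_disjoint (I := (I : Set V)) hy a ha
      rcases touch_mk.1 ht with h1 | h1
      · exact haI h1
      · exact hcon a ((mem_bd hlf).2 ⟨⟨b, h1, hab.symm⟩, haI⟩) ha
    exact hb' (this ▸ hb)
  refine le_trans ?_ (Finset.single_le_sum hnn hz)
  rw [if_pos ⟨mem_cl_symm hzy, by rw [cl_eq_of_mem hzy]; exact hb'⟩]

lemma mul_bexp_off_le {p q : ℝ} (hp0 : 0 ≤ p) (hpq : p ≤ q) (hq1 : q ≤ 1) {s : ℝ} (hs : 0 ≤ s)
    (Ω : Finset V) {I : Set V} {a y : V} (ha : a ∉ I) (hy : y ∉ I) (hay : G.Adj a y) :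
    p * bexp q (tE hlf Ω) (fun S => 1 - wt s Ω (cl G (off I S) y))
      ≤ bexp q (tE hlf Ω) (fun S => 1 - wt s Ω (cl G (off I S) a)) := by
  have hq0 : 0 ≤ q := hp0.trans hpq
  have hnn : ∀ x S, 0 ≤ 1 - wt s Ω (cl G (off I S) x) := fun x S =>
    sub_nonneg.2 (wt_le_one hs _ _)
  by_cases he : s(a, y) ∈ tE hlf Ω
  · refine le_trans (mul_le_mul_of_nonneg_right hpq (bexp_nonneg hq0 hq1 (hnn y)))
      (mul_bexp_le_of_mem hq0 hq1 he (hnn a) ?_ ?_)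
    · intro S T hST
      exact sub_le_sub_left (wt_cl_anti hs Ω y (off_mono I hST)) 1
    · intro S hS
      have : y ∈ cl G (off I S) a := mem_cl_step (self_mem_cl _ _) hay
        (mem_off.2 ⟨hS, fun ht => by
          rcases touch_mk.1 ht with h | h
          · exact ha h
          · exact hy h⟩)
      rw [cl_eq_of_mem this]
  · have haΩ : a ∉ Ω := fun h => he ((mem_tE hlf).2 ⟨hay, touch_left y h⟩)
    have : (fun S => 1 - wt s Ω (cl G (off I S) a)) = fun _ => (1 : ℝ) := by
      funext S
      rw [wt, if_neg fun hc => haΩ (hc (self_mem_cl _ _)), sub_zero]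
    rw [this, bexp_const]
    exact mul_le_one₀ (hpq.trans hq1) (bexp_nonneg hq0 hq1 (hnn y))
      (bexp_le_one hq0 hq1 fun S => by linarith [wt_nonneg s Ω (cl G (off I S) y)])

lemma exists_bd_of_mem_nbh {p q : ℝ} (hp0 : 0 ≤ p) (hpq : p ≤ q) (hq1 : q ≤ 1) {s : ℝ}
    (hs : 0 ≤ s) (Ω I : Finset V) (k : ℕ) {y : V} (hy : y ∈ nbh hlf I k) (hyI : y ∉ I) :
    ∃ z ∈ bd hlf I, y ∈ nbh hlf {z} k ∧
      p ^ k * bexp q (tE hlf Ω) (fun S => 1 - wt s Ω (cl G (off I S) y))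
        ≤ bexp q (tE hlf Ω) (fun S => 1 - wt s Ω (cl G (off I S) z)) := by
  have hp1 : p ≤ 1 := hpq.trans hq1
  have hnn : ∀ x, 0 ≤ bexp q (tE hlf Ω) (fun S => 1 - wt s Ω (cl G (off I S) x)) := fun x =>
    bexp_nonneg (hp0.trans hpq) hq1 fun S => sub_nonneg.2 (wt_le_one hs _ _)
  induction k generalizing y with
  | zero => exact absurd hy hyI
  | succ k ih =>
    rcases (mem_nbh_succ hlf).1 hy with hy | ⟨a, ha, hay⟩
    · obtain ⟨z, hz, hyz, hle⟩ := ih hy hyI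
      refine ⟨z, hz, nbh_mono hlf _ (Nat.le_succ k) hyz, le_trans ?_ hle⟩
      exact mul_le_mul_of_nonneg_right (pow_le_pow_of_le_one hp0 hp1 (Nat.le_succ k)) (hnn y)
    · by_cases haI : a ∈ I
      · refine ⟨y, (mem_bd hlf).2 ⟨⟨a, haI, hay⟩, hyI⟩,
          nbh_mono hlf _ (Nat.zero_le _) (Finset.mem_singleton_self y), ?_⟩
        exact mul_le_of_le_one_left (hnn y) (pow_le_one₀ hp0 hp1)
      · obtain ⟨z, hz, haz, hle⟩ := ih ha haI
        refine ⟨z, hz, (mem_nbh_succ hlf).2 (Or.inr ⟨a, haz, hay⟩), le_trans ?_ hle⟩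
        rw [pow_succ, mul_assoc]
        exact mul_le_mul_of_nonneg_left
          (mul_bexp_off_le hlf hp0 hpq hq1 hs Ω (I := (I : Set V)) haI hyI hay)
          (pow_nonneg hp0 k)

end Weights

section Expansion

open scoped Classical

variable {G : SimpleGraph V} (hlf : ∀ v, (G.neighborSet v).Finite)

lemma mul_sum_bexp_off_le {d : ℕ} (hreg : ∀ v, (G.neighborSet v).ncard = d) {p q h s : ℝ}
    (hp0 : 0 ≤ p) (hpq : p ≤ q) (hq1 : q ≤ 1) (hs : 0 ≤ s) (k : ℕ)
    (hk : ((d : ℝ) + 1) ^ k * h ≤ p ^ k) (Ω I : Finset V) :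
    h * ∑ y ∈ nbh hlf I k \ I, bexp q (tE hlf Ω) (fun S => 1 - wt s Ω (cl G (off I S) y))
      ≤ ∑ z ∈ bd hlf I, bexp q (tE hlf Ω) (fun S => 1 - wt s Ω (cl G (off I S) z)) := by
  set Y : V → ℝ := fun x => bexp q (tE hlf Ω) (fun S => 1 - wt s Ω (cl G (off I S) x)) with hY
  have hnn : ∀ x, 0 ≤ Y x := fun x =>
    bexp_nonneg (hp0.trans hpq) hq1 fun S => sub_nonneg.2 (wt_le_one hs _ _)
  change h * ∑ y ∈ nbh hlf I k \ I, Y y ≤ ∑ z ∈ bd hlf I, Y z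
  have h1 : p ^ k * ∑ y ∈ nbh hlf I k \ I, Y y
      ≤ ((d : ℝ) + 1) ^ k * ∑ z ∈ bd hlf I, Y z := by
    calc _ ≤ ∑ y ∈ nbh hlf I k \ I, ∑ z ∈ bd hlf I, if y ∈ nbh hlf {z} k then Y z else 0 := by
          rw [Finset.mul_sum]
          refine Finset.sum_le_sum fun y hy => ?_
          rw [Finset.mem_sdiff] at hy
          obtain ⟨z, hz, hyz, hle⟩ := exists_bd_of_mem_nbh hlf hp0 hpq hq1 hs Ω I k hy.1 hy.2
          refine hle.trans (le_trans ?_ (Finset.single_le_sum (f := fun z =>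
            if y ∈ nbh hlf {z} k then Y z else 0) (fun z _ => ?_) hz))
          · simp only [if_pos hyz]; exact le_rfl
          · split_ifs
            · exact hnn z
            · exact le_rfl
      _ = ∑ z ∈ bd hlf I, ∑ y ∈ nbh hlf I k \ I, if y ∈ nbh hlf {z} k then Y z else 0 :=
          Finset.sum_comm
      _ ≤ _ := by
          rw [Finset.mul_sum]
          refine Finset.sum_le_sum fun z _ => ?_
          rw [← Finset.sum_filter, Finset.sum_const, nsmul_eq_mul]
          refine mul_le_mul_of_nonneg_right ?_ (hnn z)
          have h2 : ((nbh hlf I k \ I).filter (· ∈ nbh hlf {z} k)).card ≤ (d + 1) ^ k :=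
            (Finset.card_le_card fun y hy => (Finset.mem_filter.1 hy).2).trans
              (card_nbh_le hlf hreg z k)
          exact_mod_cast h2
  have hS : 0 ≤ ∑ y ∈ nbh hlf I k \ I, Y y := Finset.sum_nonneg fun y _ => hnn y
  have h3 := mul_le_mul_of_nonneg_right hk hS
  have h4 : (0 : ℝ) < ((d : ℝ) + 1) ^ k := by positivity
  refine le_of_mul_le_mul_left ?_ h4
  linarith

lemma sum_mem_not_big_le {h s θ B : ℝ} (hB : 1 ≤ B) (hθ1 : θ ≤ 1) (hs : h ≤ B * s)
    (hs0 : 0 ≤ s) (hsh : s ≤ h) (Ω D : Finset V) (K : Set V) :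
    h * ∑ y ∈ D, (if y ∈ K ∧ ¬ big h θ Ω K then (1 : ℝ) else 0) ≤ 2 * B * (1 - wt s Ω K) := by
  by_cases hb : big h θ Ω K
  · simp only [hb, not_true_eq_false, and_false, if_false, Finset.sum_const_zero, mul_zero]
    have := wt_le_one hs0 Ω K
    exact mul_nonneg (by linarith) (by linarith)
  · refine le_trans ?_ (small_le hB hθ1 hs hs0 hsh Ω K hb)
    refine mul_le_mul_of_nonneg_left ?_ (hs0.trans hsh)
    have hK : K ⊆ Ω := by by_contra hc; exact hb (Or.inl hc)
    simp only [hb, not_false_eq_true, and_true]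
    rw [← Finset.sum_filter, Finset.sum_const, nsmul_eq_mul, mul_one, ← Set.ncard_coe_finset]
    exact_mod_cast Set.ncard_le_ncard (fun y hy => (Finset.mem_filter.1 hy).2)
      (Ω.finite_toSet.subset hK)

lemma card_le_sum_bd {d : ℕ} (hreg : ∀ v, (G.neighborSet v).ncard = d) {c : ℝ} (hc : 0 ≤ c)
    (hexp : ∀ I : Finset V, c * (I.card : ℝ) ≤ ((bd hlf I).card : ℝ)) {p q h s θ B : ℝ}
    (hp0 : 0 ≤ p) (hpq : p ≤ q) (hq1 : q ≤ 1) (hB : 1 ≤ B) (hθ : 0 < θ) (hθ1 : θ ≤ 1)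
    (hs : h ≤ B * s) (hs0 : 0 ≤ s) (hsh : s ≤ h) (k : ℕ)
    (hk : ((d : ℝ) + 1) ^ k * h ≤ p ^ k) (Ω I : Finset V)
    (hbig : ∀ y, θ / 2 ≤ bexp q (tE hlf Ω) fun S => if big h θ Ω (cl G S y) then 1 else 0) :
    θ ^ 2 / (12 * B) * h * ((1 + c) ^ k - 1) * I.card
      ≤ ∑ z ∈ bd hlf I, bexp q (tE hlf Ω) (fun S => 1 - wt s Ω (cl G (off I S) z)) := by
  have hq0 : 0 ≤ q := hp0.trans hpq
  have hh : 0 ≤ h := hs0.trans hsh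
  have hB0 : 0 < B := by linarith
  set E := tE hlf Ω with hE
  set Y : V → ℝ := fun x => bexp q E (fun S => 1 - wt s Ω (cl G (off I S) x)) with hY
  set Z := ∑ z ∈ bd hlf I, Y z with hZ
  change _ ≤ Z
  set D := nbh hlf I k \ I with hD
  have hIn : I ⊆ nbh hlf I k := nbh_mono hlf I (Nat.zero_le k)
  have hcard : ((1 + c) ^ k - 1) * (I.card : ℝ) ≤ D.card := by
    have h1 := le_card_nbh hlf hc hexp I k
    have h2 : (D.card : ℝ) = (nbh hlf I k).card - I.card := by
      rw [hD, Finset.card_sdiff_of_subset hIn, Nat.cast_sub (Finset.card_le_card hIn)]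
    rw [h2]; linarith
  have hA : h * ∑ y ∈ D, Y y ≤ Z := mul_sum_bexp_off_le hlf hreg hp0 hpq hq1 hs0 k hk Ω I
  set X : V → V → ℝ := fun y z => bexp q E fun S =>
    if y ∈ cl G (off I S) z ∧ ¬ big h θ Ω (cl G (off I S) z) then (1 : ℝ) else 0 with hX
  have hpt : ∀ y ∈ D, θ * (θ / 2) ≤ 4 * B * Y y + θ * ∑ z ∈ bd hlf I, X y z := by
    intro y hy
    have hyI := (Finset.mem_sdiff.1 hy).2
    have h1 : θ / 2 ≤ bexp q E (fun S => if big h θ Ω (cl G (off I S) y) then 1 else 0)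
        + ∑ z ∈ bd hlf I, X y z := by
      refine (hbig y).trans ?_
      rw [hX, ← bexp_sum, ← bexp_add]
      exact bexp_mono hq0 hq1 fun S _ => big_le_add hlf hyI S
    have h2 : θ * bexp q E (fun S => if big h θ Ω (cl G (off I S) y) then 1 else 0)
        ≤ 4 * B * Y y := by
      rw [hY, ← bexp_const_mul, ← bexp_const_mul]
      refine bexp_mono hq0 hq1 fun S _ => ?_
      by_cases hb : big h θ Ω (cl G (off I S) y)
      · rw [if_pos hb, mul_one]; exact big_le hB hθ hθ1 hs Ω _ hb
      · rw [if_neg hb, mul_zero]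
        have := wt_le_one hs0 Ω (cl G (off I S) y)
        exact mul_nonneg (by linarith) (by linarith)
    nlinarith [mul_le_mul_of_nonneg_left h1 hθ.le]
  have hBd : h * ∑ y ∈ D, ∑ z ∈ bd hlf I, X y z ≤ 2 * B * Z := by
    rw [Finset.sum_comm, Finset.mul_sum, hZ, Finset.mul_sum]
    refine Finset.sum_le_sum fun z _ => ?_
    rw [hX, hY, ← bexp_sum, ← bexp_const_mul, ← bexp_const_mul]
    exact bexp_mono hq0 hq1 fun S _ => sum_mem_not_big_le hB hθ1 hs hs0 hsh Ω D _
  have hsum : D.card * (θ * (θ / 2)) ≤ 4 * B * ∑ y ∈ D, Y y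
      + θ * ∑ y ∈ D, ∑ z ∈ bd hlf I, X y z := by
    have := Finset.sum_le_sum hpt
    rwa [Finset.sum_const, nsmul_eq_mul, Finset.sum_add_distrib, ← Finset.mul_sum,
      ← Finset.mul_sum] at this
  have hZ0 : 0 ≤ Z := Finset.sum_nonneg fun z _ =>
    bexp_nonneg hq0 hq1 fun S => sub_nonneg.2 (wt_le_one hs0 _ _)
  have hfin : h * (D.card * (θ * (θ / 2))) ≤ 6 * B * Z := by
    have e1 := mul_le_mul_of_nonneg_left hsum hh
    have e2 := mul_le_mul_of_nonneg_left hA (by linarith : 0 ≤ 4 * B)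
    have e3 := mul_le_mul_of_nonneg_left hBd hθ.le
    have e4 : θ * (2 * B * Z) ≤ 1 * (2 * B * Z) := by gcongr
    nlinarith
  calc _ = θ ^ 2 / (12 * B) * h * (((1 + c) ^ k - 1) * I.card) := by ring
    _ ≤ θ ^ 2 / (12 * B) * h * D.card := by gcongr
    _ = h * (D.card * (θ * (θ / 2))) / (6 * B) := by field_simp; ring
    _ ≤ Z := by rw [div_le_iff₀ (by positivity)]; linarith

end Expansion

section Ghost

open scoped Classical

variable {G : SimpleGraph V} (hlf : ∀ v, (G.neighborSet v).Finite)

lemma sum_pivotal_le_neg {s : ℝ} (hs : 0 ≤ s) (Ω : Finset V) (o : V) (S : Finset (Sym2 V)) :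
    ∑ e ∈ tE hlf Ω, (wt s Ω (cl G (insert e S) o) - wt s Ω (cl G (S.erase e) o))
      ≤ - ∑ I ∈ Ω.powerset, (if cl G S o = (I : Set V) then
          wt s Ω I * ∑ z ∈ bd hlf I, (1 - wt s Ω (cl G (off I S) z)) else 0) := by
  set f : Finset (Sym2 V) → ℝ := fun S => wt s Ω (cl G S o) with hf
  have hfm : Antitone f := wt_cl_anti hs Ω o
  change ∑ e ∈ tE hlf Ω, (f (insert e S) - f (S.erase e)) ≤ _
  have hnp : ∀ e ∈ tE hlf Ω, f (insert e S) - f (S.erase e) ≤ 0 := fun e _ =>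
    sub_nonpos.2 (hfm ((Finset.erase_subset e S).trans (Finset.subset_insert e S)))
  by_cases hK : cl G S o ⊆ Ω
  swap
  · rw [Finset.sum_eq_zero (s := Ω.powerset), neg_zero]
    · exact Finset.sum_nonpos hnp
    · intro I hI
      rw [if_neg]
      intro hc
      exact hK (hc ▸ by exact_mod_cast Finset.mem_powerset.1 hI)
  rw [sum_ite_set_eq Ω hK]
  set I := Ω.filter (· ∈ cl G S o) with hI
  have hIc : (I : Set V) = cl G S o := by
    ext y; simp only [hI, Finset.coe_filter, Set.mem_ofPred_eq]
    exact ⟨fun h => h.2, fun h => ⟨hK h, h⟩⟩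
  have hIΩ : I ⊆ Ω := Finset.filter_subset _ _
  choose! x hx using fun z (hz : z ∈ bd hlf I) => ((mem_bd hlf).1 hz).1
  have hzI : ∀ z ∈ bd hlf I, z ∉ I := fun z hz => ((mem_bd hlf).1 hz).2
  let m : V → Sym2 V := fun z => s(x z, z)
  have hinj : Set.InjOn m (bd hlf I) := by
    intro z hz z' hz' h
    simp only [m, Sym2.eq_iff] at h
    rcases h with ⟨_, h⟩ | ⟨h1, _⟩
    · exact h
    · exact absurd (h1 ▸ (hx z hz).1) (hzI z' hz')
  have hfS : f S = wt s Ω (I : Set V) := by rw [hIc]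
  rw [Finset.mul_sum, ← Finset.sum_neg_distrib]
  calc _ ≤ ∑ e ∈ (bd hlf I).image m, (f (insert e S) - f (S.erase e)) := by
        have hsub : (bd hlf I).image m ⊆ tE hlf Ω := by
          intro e he
          obtain ⟨z, hz, rfl⟩ := Finset.mem_image.1 he
          exact (mem_tE hlf).2 ⟨(hx z hz).2, touch_left _ (hIΩ (hx z hz).1)⟩
        rw [← Finset.sum_sdiff hsub]
        refine add_le_of_nonpos_left (Finset.sum_nonpos fun e he => hnp e ?_)
        exact (Finset.mem_sdiff.1 he).1
    _ = ∑ z ∈ bd hlf I, (f (insert (m z) S) - f (S.erase (m z))) := Finset.sum_image hinj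
    _ ≤ _ := by
        refine Finset.sum_le_sum fun z hz => ?_
        have hzc : z ∉ (I : Set V) := fun h => hzI z hz h
        have hxo : x z ∈ cl G S o := by rw [← hIc]; exact (hx z hz).1
        have h1 : f S ≤ f (S.erase (m z)) := hfm (Finset.erase_subset _ _)
        have hd : Disjoint (cl G S o) (cl G S z) := by
          rw [Set.disjoint_left]
          intro a ha haz
          exact hzc (hIc ▸ mem_cl_trans ha (mem_cl_symm haz))
        have h2 : f (insert (m z) S) ≤ wt s Ω (I : Set V) * wt s Ω (cl G S z) := by
          have := wt_anti hs Ω (cl_union_subset_insert hxo (hx z hz).2)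
          rwa [wt_union s Ω hd, ← hIc] at this
        rw [cl_off_of_cl_eq hIc.symm hzc]
        rw [hfS] at h1
        linarith

lemma bexp_pivotal_add_le {q s κ A : ℝ} (hq0 : 0 ≤ q) (hq1 : q ≤ 1) (hs : 0 ≤ s) (hκ : κ ≤ A)
    (Ω : Finset V) (o : V)
    (hZ : ∀ I : Finset V, A * I.card
      ≤ ∑ z ∈ bd hlf I, bexp q (tE hlf Ω) (fun S => 1 - wt s Ω (cl G (off I S) z))) :
    bexp q (tE hlf Ω) (fun S => ∑ e ∈ tE hlf Ω,
        (wt s Ω (cl G (insert e S) o) - wt s Ω (cl G (S.erase e) o)))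
      + bexp q (tE hlf Ω) (fun S => κ * (cl G S o).ncard * wt s Ω (cl G S o)) ≤ 0 := by
  set E := tE hlf Ω with hE
  have h1 := bexp_mono hq0 hq1 (E := E) fun S _ => sum_pivotal_le_neg hlf hs Ω o S
  rw [bexp_neg] at h1
  have h2 : bexp q E (fun S => κ * (cl G S o).ncard * wt s Ω (cl G S o))
      = ∑ I ∈ Ω.powerset, bexp q E fun S =>
        if cl G S o = (I : Set V) then κ * I.card * wt s Ω I else 0 := by
    rw [← bexp_sum]
    refine bexp_congr fun S _ => ?_
    by_cases hK : cl G S o ⊆ Ω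
    · rw [sum_ite_set_eq Ω hK]
      have hIc : ((Ω.filter (· ∈ cl G S o) : Finset V) : Set V) = cl G S o := by
        ext y; simp only [Finset.coe_filter, Set.mem_ofPred_eq]
        exact ⟨fun h => h.2, fun h => ⟨hK h, h⟩⟩
      rw [← Set.ncard_coe_finset, hIc]
    · rw [Finset.sum_eq_zero, wt, if_neg hK, mul_zero]
      intro I hI
      rw [if_neg]
      intro hc
      exact hK (hc ▸ by exact_mod_cast Finset.mem_powerset.1 hI)
  have h3 : ∀ I ∈ Ω.powerset,
      bexp q E (fun S => if cl G S o = (I : Set V) then κ * I.card * wt s Ω I else 0)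
      ≤ bexp q E (fun S => if cl G S o = (I : Set V) then
          wt s Ω I * ∑ z ∈ bd hlf I, (1 - wt s Ω (cl G (off I S) z)) else 0) := by
    intro I _
    set a : Finset (Sym2 V) → ℝ := fun S => if cl G S o = (I : Set V) then 1 else 0 with ha
    set b : Finset (Sym2 V) → ℝ := fun S => ∑ z ∈ bd hlf I, (1 - wt s Ω (cl G (off I S) z))
      with hb
    have e1 : (fun S => if cl G S o = (I : Set V) then κ * I.card * wt s Ω I else 0)
        = fun S => (κ * I.card * wt s Ω I) * a S := by
      funext S; simp only [ha]; split_ifs <;> simp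
    have e2 : (fun S => if cl G S o = (I : Set V) then
        wt s Ω I * ∑ z ∈ bd hlf I, (1 - wt s Ω (cl G (off I S) z)) else 0)
        = fun S => wt s Ω I * (a S * b S) := by
      funext S; simp only [ha, hb]; split_ifs <;> simp
    have hda : DepOn (touch (I : Set V)) a := by
      intro S T h
      have := cl_eq_iff_of_agree (G := G) h o
      simp only [ha, this]
    have hdb : DepOn (fun e => ¬ touch (I : Set V) e) b := by
      intro S T h
      have : off (I : Set V) S = off I T := by
        ext e
        rw [mem_off, mem_off]
        exact and_congr_left fun ht => h e ht
      simp only [hb, this]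
    rw [e1, e2, bexp_const_mul, bexp_const_mul, bexp_mul_of_depOn q E _ hda hdb]
    have ha0 : 0 ≤ bexp q E a :=
      bexp_nonneg hq0 hq1 fun S => by simp only [ha]; split_ifs <;> norm_num
    have hbE : κ * I.card ≤ bexp q E b := by
      have := hZ I
      rw [← bexp_sum] at this
      exact le_trans (by gcongr) this
    have hw := wt_nonneg s Ω (I : Set V)
    calc _ = wt s Ω I * (bexp q E a * (κ * I.card)) := by ring
      _ ≤ _ := by gcongr
  have h4 := Finset.sum_le_sum h3
  rw [← h2, ← bexp_sum] at h4
  linarith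

lemma hasDerivAt_wt (h κ p₀ q : ℝ) (Ω : Finset V) (K : Set V) :
    HasDerivAt (fun q => wt (h - κ * (q - p₀)) Ω K)
      (κ * K.ncard * wt (h - κ * (q - p₀)) Ω K) q := by
  by_cases hK : K ⊆ Ω
  · simp only [wt, if_pos hK]
    have h1 : HasDerivAt (fun q : ℝ => -((h - κ * (q - p₀)) * (K.ncard : ℝ)))
        (κ * K.ncard) q := by
      have := ((((hasDerivAt_id q).sub_const p₀).const_mul κ).const_sub h).mul_const (K.ncard : ℝ)
      exact this.neg.congr_deriv (by ring)
    simpa [mul_comm] using h1.exp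
  · simp only [wt, if_neg hK, mul_zero]
    exact hasDerivAt_const q 0

/-- Lowering the ghost field from `h` to `h'` is compensated by raising the percolation
parameter from `p₀` to `p'`. -/
lemma ghost_step {d : ℕ} (hreg : ∀ v, (G.neighborSet v).ncard = d) {c : ℝ} (hc : 0 ≤ c)
    (hexp : ∀ I : Finset V, c * (I.card : ℝ) ≤ ((bd hlf I).card : ℝ)) {p p₀ p' h h' θ B : ℝ}
    (hp0 : 0 ≤ p) (hpp : p ≤ p₀) (hp' : p₀ < p') (hp1 : p' ≤ 1) (hB : 1 ≤ B) (hθ : 0 < θ)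
    (hθ1 : θ ≤ 1) (hh' : 0 ≤ h') (hhh : h' ≤ h) (hhB : h ≤ B * h') (k : ℕ)
    (hk : ((d : ℝ) + 1) ^ k * h ≤ p ^ k)
    (hslope : h ≤ (p' - p₀) * (θ ^ 2 / (12 * B) * h * ((1 + c) ^ k - 1)))
    (Ω : Finset V) (hstart : ∀ y, θ ≤ bexp p₀ (tE hlf Ω) fun S => 1 - wt h Ω (cl G S y)) (o : V) :
    θ ≤ bexp p' (tE hlf Ω) fun S => 1 - wt h' Ω (cl G S o) := by
  have hpos : 0 < p' - p₀ := sub_pos.2 hp'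
  have hp00 : 0 ≤ p₀ := hp0.trans hpp
  set E := tE hlf Ω with hE
  set κ := (h - h') / (p' - p₀) with hκ
  have hκ0 : 0 ≤ κ := div_nonneg (sub_nonneg.2 hhh) hpos.le
  have hκe : κ * (p' - p₀) = h - h' := div_mul_cancel₀ _ hpos.ne'
  set A := θ ^ 2 / (12 * B) * h * ((1 + c) ^ k - 1) with hA
  have hκA : κ ≤ A := by
    rw [hκ, div_le_iff₀ hpos]; linarith
  set φ : ℝ → ℝ := fun q => bexp q E fun S => wt (h - κ * (q - p₀)) Ω (cl G S o) with hφ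
  have hder : ∀ q, HasDerivAt φ _ q := fun q =>
    hasDerivAt_bexp E (fun q S => wt (h - κ * (q - p₀)) Ω (cl G S o)) _ q
      fun S => hasDerivAt_wt h κ p₀ q Ω (cl G S o)
  obtain ⟨q, ⟨hq0, hq1⟩, hq⟩ := exists_hasDerivAt_eq_slope φ _ hp'
    (fun q _ => (hder q).continuousAt.continuousWithinAt) (fun q _ => hder q)
  set s := h - κ * (q - p₀) with hs
  have hs1 : s ≤ h := by
    have := mul_nonneg hκ0 (sub_nonneg.2 hq0.le); linarith
  have hs2 : h' ≤ s := by
    have : κ * (q - p₀) ≤ κ * (p' - p₀) := by gcongr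
    linarith
  have hs0 : 0 ≤ s := hh'.trans hs2
  have hsB : h ≤ B * s := hhB.trans (by gcongr)
  have hq1' : q ≤ 1 := hq1.le.trans hp1
  have hq0' : 0 ≤ q := hp00.trans hq0.le
  have hbig : ∀ y, θ / 2 ≤ bexp q E fun S => if big h θ Ω (cl G S y) then 1 else 0 := by
    intro y
    have h1 : θ ≤ bexp p₀ E (fun S => if big h θ Ω (cl G S y) then 1 else 0) + θ / 2 := by
      refine (hstart y).trans ?_
      refine (bexp_mono hp00 (hp'.le.trans hp1) fun S _ =>
        one_sub_wt_le_big hθ.le Ω (cl G S y)).trans ?_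
      rw [bexp_add, bexp_const]
    have h2 := bexp_mono_param hp00 hq0.le hq1' E (big_cl_mono (G := G) (θ := θ)
      (hh'.trans hhh) Ω y)
    linarith
  have hle := bexp_pivotal_add_le hlf hq0' hq1' hs0 hκA Ω o fun I =>
    card_le_sum_bd hlf hreg hc hexp hp0 (hpp.trans hq0.le) hq1' hB hθ hθ1 hsB hs0 hs1 k hk Ω I hbig
  have hφle : φ p' ≤ φ p₀ := by
    have h1 := hq.symm.trans_le hle
    rw [div_le_iff₀ hpos] at h1
    linarith
  have e0 : φ p₀ = bexp p₀ E fun S => wt h Ω (cl G S o) := by simp [hφ]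
  have e1 : φ p' = bexp p' E fun S => wt h' Ω (cl G S o) := by
    simp only [hφ, hκe, sub_sub_cancel]
  have h0 := hstart o
  rw [bexp_sub, bexp_const] at h0 ⊢
  linarith

end Ghost

section Uniform

open scoped Classical

variable {G : SimpleGraph V} (hlf : ∀ v, (G.neighborSet v).Finite)

lemma le_ncard_cl {S : Finset (Sym2 V)} {y : V} {N : ℕ} (hfin : (cl G S y).Finite)
    (hN : ¬ cl G S y ⊆ nbh hlf {y} N) : N ≤ (cl G S y).ncard := by
  obtain ⟨x, hx, hxN⟩ := Set.not_subset.1 hN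
  obtain ⟨w, hw⟩ := SimpleGraph.Reachable.exists_isPath (show (opn G S).Reachable y x from hx)
  have hle : opn G S ≤ G := fun a b h => h.1
  have hlen : N < w.length := by
    by_contra hlt
    refine hxN ((mem_nbh_singleton hlf).2 ⟨w.mapLe hle, ?_⟩)
    simpa using hlt
  have hsub : ((w.support.toFinset : Finset V) : Set V) ⊆ cl G S y := by
    intro a ha
    have ha' : a ∈ w.support := by simpa using ha
    exact (w.takeUntil a ha').reachable
  have h1 := Set.ncard_le_ncard hsub hfin
  rw [Set.ncard_coe_finset, List.toFinset_card_of_nodup hw.support_nodup,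
    SimpleGraph.Walk.length_support] at h1
  omega

lemma le_bexp_of_le_ex {p h θ : ℝ} (h0 : 0 ≤ p) (h1 : p ≤ 1) (hh : 0 ≤ h) {N : ℕ}
    (hN : 1 ≤ h * N) (Ω : Finset V) (y : V) (hy : 2 * θ ≤ ex hlf p (nbh hlf {y} N) y) :
    θ ≤ bexp p (tE hlf Ω) fun S => 1 - wt h Ω (cl G S y) := by
  have hmon : Monotone fun S : Finset (Sym2 V) => 2 * (1 - wt h Ω (cl G S y)) := fun S T hST =>
    mul_le_mul_of_nonneg_left (sub_le_sub_left (wt_cl_anti hh Ω y hST) 1) zero_le_two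
  have hdep : DepOn (· ∈ tE hlf Ω)
      fun S : Finset (Sym2 V) => 2 * (1 - wt h Ω (cl G S y)) := by
    intro S T hST
    have := wt_cl_depOn hlf h Ω y S T hST
    simp only at this
    simp only [this]
  have key : ex hlf p (nbh hlf {y} N) y
      ≤ bexp p (tE hlf Ω) fun S => 2 * (1 - wt h Ω (cl G S y)) := by
    refine bexp_le_of_le h0 h1 _ _ hmon hdep fun S => ?_
    have hle := wt_le_one hh Ω (cl G S y)
    by_cases hS : cl G S y ⊆ nbh hlf {y} N
    · rw [if_pos hS]; linarith
    rw [if_neg hS]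
    by_cases hK : cl G S y ⊆ Ω
    · have hn : (N : ℝ) ≤ (cl G S y).ncard := by
        exact_mod_cast le_ncard_cl hlf (Ω.finite_toSet.subset hK) hS
      have h2 : 1 ≤ h * (cl G S y).ncard := hN.trans (by gcongr)
      have h3 : Real.exp (-(h * (cl G S y).ncard)) ≤ Real.exp (-1) :=
        Real.exp_le_exp.2 (by linarith)
      have h4 := half_le_one_sub_exp_neg zero_le_one le_rfl
      rw [wt, if_pos hK]
      linarith
    · rw [wt, if_neg hK]; norm_num
  rw [bexp_const_mul] at key
  linarith

lemma bexp_le_ex_add {p h : ℝ} (h0 : 0 ≤ p) (h1 : p ≤ 1) (hh : 0 ≤ h) (Ω : Finset V) (o : V) :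
    bexp p (tE hlf Ω) (fun S => 1 - wt h Ω (cl G S o)) ≤ ex hlf p Ω o + h * Ω.card := by
  rw [ex, ← bexp_const p (tE hlf Ω) (h * Ω.card), ← bexp_add]
  refine bexp_mono h0 h1 fun S _ => ?_
  by_cases hK : cl G S o ⊆ Ω
  · rw [wt, if_pos hK, if_pos hK]
    have h2 : ((cl G S o).ncard : ℝ) ≤ Ω.card := by
      rw [← Set.ncard_coe_finset]
      exact_mod_cast Set.ncard_le_ncard hK Ω.finite_toSet
    have h3 := Real.add_one_le_exp (-(h * (cl G S o).ncard))
    have h4 : h * (cl G S o).ncard ≤ h * Ω.card := by gcongr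
    linarith
  · rw [wt, if_neg hK, if_neg hK]
    have : 0 ≤ h * Ω.card := by positivity
    linarith

/-- Iterating `ghost_step` along a geometric sequence of ghost fields. -/
lemma ghost_iterate {d : ℕ} (hreg : ∀ v, (G.neighborSet v).ncard = d) {c : ℝ} (hc : 0 < c)
    (hexp : ∀ I : Finset V, c * (I.card : ℝ) ≤ ((bd hlf I).card : ℝ)) {p δ θ B M : ℝ}
    (hp : 0 < p) (hpδ : p + δ ≤ 1) (hθ : 0 < θ) (hθ1 : θ ≤ 1) (hB : B = (d + 2) / p)
    (hM : M = 12 * B * (1 + c) / (θ ^ 2 * c)) {k₀ : ℕ} (hk₀ : 1 ≤ k₀)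
    (hδ : M * ((1 + c)⁻¹ ^ k₀ / (1 - (1 + c)⁻¹)) ≤ δ) (Ω : Finset V)
    (hstart : ∀ y, θ ≤ bexp p (tE hlf Ω) fun S => 1 - wt (B⁻¹ ^ k₀) Ω (cl G S y)) (j : ℕ) (y : V) :
    θ ≤ bexp (p + M * ((1 + c)⁻¹ ^ k₀ * (1 - (1 + c)⁻¹ ^ j) / (1 - (1 + c)⁻¹))) (tE hlf Ω)
      fun S => 1 - wt (B⁻¹ ^ (k₀ + j)) Ω (cl G S y) := by
  set ρ := (1 + c)⁻¹ with hρ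
  have hρ0 : 0 < ρ := by positivity
  have hρ1 : ρ < 1 := by rw [hρ]; exact inv_lt_one_of_one_lt₀ (by linarith)
  have hρ' : 0 < 1 - ρ := sub_pos.2 hρ1
  have hρc : ρ * (1 + c) = 1 := by rw [hρ]; field_simp
  have hB0 : 0 < B := by rw [hB]; positivity
  have hδ0 : 0 < M := by rw [hM]; positivity
  have hp1 : p ≤ 1 := by
    have : 0 ≤ M * (ρ ^ k₀ / (1 - ρ)) := by positivity
    linarith
  have hBp : B * p = d + 2 := by rw [hB]; field_simp
  have hB1 : 1 ≤ B := by
    have : (0 : ℝ) ≤ d := Nat.cast_nonneg d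
    rw [hB, le_div_iff₀ hp]; linarith
  induction j generalizing y with
  | zero => simpa using hstart y
  | succ j ih =>
    set k := k₀ + j with hkdef
    set a := p + M * (ρ ^ k₀ * (1 - ρ ^ j) / (1 - ρ)) with ha
    set b := p + M * (ρ ^ k₀ * (1 - ρ ^ (j + 1)) / (1 - ρ)) with hb
    have hba : b - a = M * ρ ^ k := by
      rw [ha, hb, hkdef, pow_add]
      field_simp
      ring
    have hpa : p ≤ a := by
      have : 0 ≤ 1 - ρ ^ j := sub_nonneg.2 (pow_le_one₀ hρ0.le hρ1.le)
      have : 0 ≤ M * (ρ ^ k₀ * (1 - ρ ^ j) / (1 - ρ)) := by positivity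
      linarith
    have hb1 : b ≤ 1 := by
      have h1 : M * (ρ ^ k₀ * (1 - ρ ^ (j + 1)) / (1 - ρ)) ≤ M * (ρ ^ k₀ / (1 - ρ)) := by
        gcongr
        have h2 : 0 < ρ ^ (j + 1) := by positivity
        exact mul_le_of_le_one_right (by positivity) (by linarith)
      linarith
    have hlt : a < b := by
      have : 0 < M * ρ ^ k := by positivity
      linarith
    have hBk : (0 : ℝ) < B⁻¹ ^ k := by positivity
    have hk1 : k ≠ 0 := by omega
    refine ghost_step hlf hreg hc.le hexp hp.le hpa hlt hb1 hB1 hθ hθ1 (by positivity)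
      (h := B⁻¹ ^ k) ?_ ?_ k ?_ ?_ Ω ih y
    · exact pow_le_pow_of_le_one (by positivity) (inv_le_one_of_one_le₀ hB1) (by omega)
    · rw [← add_assoc, pow_succ, ← hkdef]
      apply le_of_eq; field_simp
    · rw [← mul_pow]
      refine pow_le_pow_left₀ (by positivity) ?_ k
      rw [← div_eq_mul_inv, div_le_iff₀ hB0, mul_comm p, hBp]
      linarith
    · have h1 : (b - a) * (θ ^ 2 / (12 * B) * B⁻¹ ^ k * ((1 + c) ^ k - 1))
          = B⁻¹ ^ k * ((1 + c) / c * ((ρ * (1 + c)) ^ k - ρ ^ k)) := by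
        rw [hba, hM, mul_pow]
        field_simp
      rw [h1, hρc, one_pow]
      refine le_mul_of_one_le_right hBk.le ?_
      have h2 : ρ ^ k ≤ ρ := pow_le_of_le_one hρ0.le hρ1.le hk1
      rw [div_mul_eq_mul_div, le_div_iff₀ hc]
      nlinarith

lemma exists_uniform_exit (d : ℕ) {c p δ θ : ℝ} (hc : 0 < c) (hp : 0 < p) (hδ : 0 < δ)
    (hpδ : p + δ ≤ 1) (hθ : 0 < θ) (hθ1 : θ ≤ 1) :
    ∃ N : ℕ, ∀ {U : Type*} (G : SimpleGraph U) (hlf : ∀ v, (G.neighborSet v).Finite),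
      (∀ v, (G.neighborSet v).ncard = d) →
      (∀ I : Finset U, c * (I.card : ℝ) ≤ ((bd hlf I).card : ℝ)) →
      (∀ v, 2 * θ ≤ ex hlf p (nbh hlf {v} N) v) → ∀ v, 0 < theta G (p + δ) v := by
  set B : ℝ := (d + 2) / p with hB
  set M : ℝ := 12 * B * (1 + c) / (θ ^ 2 * c) with hM
  set ρ := (1 + c)⁻¹ with hρ
  have hρ0 : 0 < ρ := by positivity
  have hρ1 : ρ < 1 := by rw [hρ]; exact inv_lt_one_of_one_lt₀ (by linarith)
  have hρ' : 0 < 1 - ρ := sub_pos.2 hρ1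
  have hB0 : 0 < B := by rw [hB]; positivity
  have hM0 : 0 < M := by rw [hM]; positivity
  have hB1 : 1 < B := by
    have : (0 : ℝ) ≤ d := Nat.cast_nonneg d
    rw [hB, lt_div_iff₀ hp]; linarith
  obtain ⟨k₀, hk₀, hk₁⟩ : ∃ k₀ : ℕ, M * (ρ ^ k₀ / (1 - ρ)) ≤ δ ∧ 1 ≤ k₀ := by
    have h1 : Tendsto (fun k : ℕ => M * (ρ ^ k / (1 - ρ))) atTop (nhds (M * (0 / (1 - ρ)))) :=
      ((tendsto_pow_atTop_nhds_zero_of_lt_one hρ0.le hρ1).div_const _).const_mul M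
    rw [zero_div, mul_zero] at h1
    exact ((h1.eventually_le_const hδ).and (eventually_ge_atTop 1)).exists
  have hhk : (0 : ℝ) < B⁻¹ ^ k₀ := by positivity
  obtain ⟨N, hN⟩ := exists_nat_ge (B⁻¹ ^ k₀)⁻¹
  refine ⟨N, fun G hlf hreg hexp hv v => ?_⟩
  have hpδ0 : 0 ≤ p + δ := by linarith
  have hN' : 1 ≤ B⁻¹ ^ k₀ * N := by
    rw [inv_le_iff_one_le_mul₀ hhk] at hN; linarith
  refine hθ.trans_le (le_theta hlf hpδ0 hpδ v fun n => ?_)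
  set Ω := nbh hlf {v} n
  have hj : ∀ j : ℕ, θ ≤ ex hlf (p + δ) Ω v + B⁻¹ ^ (k₀ + j) * Ω.card := by
    intro j
    have h1 := ghost_iterate hlf hreg hc hexp hp hpδ hθ hθ1 hB hM hk₁ hk₀ Ω
      (fun y => le_bexp_of_le_ex hlf hp.le (by linarith) hhk.le hN' Ω y (hv y)) j v
    have hjn : 0 ≤ 1 - ρ ^ j := sub_nonneg.2 (pow_le_one₀ hρ0.le hρ1.le)
    have h2 : 0 ≤ M * (ρ ^ k₀ * (1 - ρ ^ j) / (1 - ρ)) := by positivity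
    have h3 : M * (ρ ^ k₀ * (1 - ρ ^ j) / (1 - ρ)) ≤ M * (ρ ^ k₀ / (1 - ρ)) := by
      gcongr
      have h4 : 0 < ρ ^ j := by positivity
      exact mul_le_of_le_one_right (by positivity) (by linarith)
    refine h1.trans (le_trans ?_ (bexp_le_ex_add hlf hpδ0 hpδ (by positivity) Ω v))
    exact bexp_mono_param (by linarith) (by linarith) hpδ _ fun S T hST =>
      sub_le_sub_left (wt_cl_anti (G := G) (by positivity) Ω v hST) 1
  have hlim : Tendsto (fun j : ℕ => ex hlf (p + δ) Ω v + B⁻¹ ^ (k₀ + j) * Ω.card) atTop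
      (nhds (ex hlf (p + δ) Ω v + 0 * Ω.card)) := by
    refine Tendsto.const_add _ (Tendsto.mul_const _ ?_)
    have := (tendsto_pow_atTop_nhds_zero_of_lt_one (inv_nonneg.2 hB0.le)
      (inv_lt_one_of_one_lt₀ hB1)).const_mul (B⁻¹ ^ k₀)
    simpa only [pow_add, mul_zero] using this
  rw [zero_mul, add_zero] at hlim
  exact ge_of_tendsto' hlim hj

end Uniform

/-- If `{G n}` is a uniformly nonamenable sequence of transitive,
locally finite, infinite connected graphs converging locally to a transitive, locally
finite, infinite connected graph `H` satisfying Assumption 1, then `p_c(G n) → p_c(H)`. -/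
theorem pc_locality_uniformly_nonamenable
    {Vn : ℕ → Type*} {W : Type*} (G : ∀ n, SimpleGraph (Vn n)) (H : SimpleGraph W)
    (hGconn : ∀ n, (G n).Connected) (hGinf : ∀ n, Infinite (Vn n))
    (hGlf : ∀ n, ∀ v : Vn n, ((G n).neighborSet v).Finite)
    (hGtrans : ∀ n, IsTransitive (G n))
    (hunif : ∃ c : ℝ, 0 < c ∧ ∀ n, c ≤ lambda1 (G n))
    (hHconn : H.Connected) (hHinf : Infinite W)
    (hHlf : ∀ w : W, (H.neighborSet w).Finite) (hHtrans : IsTransitive H)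
    (d : ℕ) (hHreg : ∀ w : W, (H.neighborSet w).ncard = d)
    (hconv : ConvergesLocally G H)
    (hA1 : Assumption1i H d) (hA2 : Assumption1ii H) :
    Filter.Tendsto (fun n => pc (G n)) Filter.atTop (nhds (pc H)) := by
  obtain ⟨c, hc, hcl⟩ := hunif
  obtain ⟨o⟩ : Nonempty W := inferInstance
  have hpcH0 := pc_nonneg H
  have hpcH1 := pc_le_one hHlf hHconn hHinf
  refine tendsto_order.2 ⟨fun a ha => ?_, fun a ha => ?_⟩
  · rcases lt_or_ge a 0 with ha0 | ha0
    · exact Eventually.of_forall fun n => ha0.trans_le (pc_nonneg _)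
    obtain ⟨p, hap, hp⟩ := exists_between ha
    obtain ⟨p', hpp', hp'⟩ := exists_between hp
    have hp0 : 0 ≤ p := ha0.trans hap.le
    have hp'0 : 0 ≤ p' := hp0.trans hpp'.le
    have hp'1 : p' ≤ 1 := hp'.le.trans hpcH1
    obtain ⟨R, hR⟩ : ∃ R, ex hHlf p' (nbh hHlf {o} R) o < (p' - p) / 2 := by
      by_contra! hcon
      exact absurd (pc_le_of_theta_pos hp'0 hp'1 ((half_pos (sub_pos.2 hpp')).trans_le
        (le_theta hHlf hp'0 hp'1 o hcon))) (not_le.2 hp')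
    obtain ⟨N, hN⟩ := hconv (R + 1)
    filter_upwards [eventually_ge_atTop N] with n hn
    by_contra! hlt
    obtain ⟨v, hv⟩ := exists_theta_pos_of_pc_lt (hGlf n) (hGconn n) (hGinf n) (hlt.trans_lt hap)
      (hpp'.le.trans hp'1)
    have h1 := le_ex_of_theta_pos (hGlf n) (hGconn n) (hGtrans n) hp0 hpp' hp'1 hv R
    rw [ex_eq_of_ballIso (hGlf n) hHlf hp'0 hp'1 (hN n hn v o)] at h1
    exact absurd hR (not_lt.2 h1)
  · rcases lt_or_ge 1 a with ha1 | ha1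
    · exact Eventually.of_forall fun n =>
        (pc_le_one (hGlf n) (hGconn n) (hGinf n)).trans_lt ha1
    obtain ⟨p, hp, hpa⟩ := exists_between ha
    obtain ⟨p₂, hpp₂, hp₂⟩ := exists_between hpa
    have hp0 : 0 < p := hpcH0.trans_lt hp
    have hp₂1 : p₂ ≤ 1 := hp₂.le.trans ha1
    have hp1 : p ≤ 1 := hpp₂.le.trans hp₂1
    obtain ⟨w, hw⟩ := exists_theta_pos_of_pc_lt hHlf hHconn hHinf hp hp1
    have hθ1 : theta H p w / 2 ≤ 1 := by
      have := (theta_le hHlf hp0.le hp1 w 0).trans (ex_le_one hHlf hp0.le hp1 _ _)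
      linarith
    obtain ⟨N, hN⟩ := exists_uniform_exit d hc hp0 (sub_pos.2 hpp₂)
      (by linarith : p + (p₂ - p) ≤ 1) (half_pos hw) hθ1
    obtain ⟨N₁, hN₁⟩ := hconv 1
    obtain ⟨N₂, hN₂⟩ := hconv (N + 1)
    filter_upwards [eventually_ge_atTop N₁, eventually_ge_atTop N₂] with n hn₁ hn₂
    have hreg : ∀ v, ((G n).neighborSet v).ncard = d := fun v => by
      rw [ncard_neighborSet_eq_of_ballIso (hN₁ n hn₁ v w), hHreg]
    have hpos := hN (G n) (hGlf n) hreg (expansion_of_le_lambda1 (hGlf n) hreg hc (hcl n))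
      fun v => by
        rw [ex_eq_of_ballIso (hGlf n) hHlf hp0.le hp1 (hN₂ n hn₂ v w)]
        have := theta_le hHlf hp0.le hp1 w N
        linarith
    have := hGinf n
    have hlt := hpos (Classical.arbitrary (Vn n))
    rw [add_sub_cancel] at hlt
    exact (pc_le_of_theta_pos (hp0.le.trans hpp₂.le) hp₂1 hlt).trans_lt hp₂

end Loc
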